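/- arXiv:0708.3947 — 4 statements merged into one kernel-verified Lean document; each statement's English description precedes it below -/
import Mathlib

section
/- Let C be a subset of the unit sphere S³ ⊆ ℝ⁴ with exactly 10 elements. Then there exist distinct points c, c' ∈ C with ⟨c, c'⟩ ≥ 1/6. (Equivalently, the Petersen code is an optimal (4,10,1/6) spherical code: there is no (4,10,t') spherical code with t' < 1/6.) -/
open scoped RealInnerProductSpace

namespace Petersen

/-- The affine coordinate in which the two Petersen inner products `1/6`, `-2/3` become `0`, `1`. -/
noncomputable def al (u : ℝ) : ℝ := (1 / 6 - u) * (6 / 5)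

noncomputable def g1 (u : ℝ) : ℝ :=
  (1 - 5 * al u) + (-4255/1691) * (al u ^ 2 - 2 * al u) + (-630/1691) * (al u ^ 3 - al u)
noncomputable def g2 (u : ℝ) : ℝ :=
  (al u ^ 2 - 2 * al u) + (-62644/38279) * (al u ^ 3 - al u)
noncomputable def g3 (u : ℝ) : ℝ := al u ^ 3 - al u
noncomputable def g4 (u : ℝ) : ℝ := al u + (-2/29) * al u ^ 2
noncomputable def g5 (u : ℝ) : ℝ := al u ^ 2

/-- The three-point kernel. -/
noncomputable def K (u v t : ℝ) : ℝ :=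
  1691/900 * (g1 u * g1 v) + 38279/6764 * (g2 u * g2 v) + 334886/114837 * (g3 u * g3 v)
  + 87/5 * (g4 u * g4 v * (t - u * v)) + 3816/145 * (g5 u * g5 v * (t - u * v))
  + 414/125 * (3 * (t - u * v) ^ 2 - (1 - u ^ 2) * (1 - v ^ 2))

/-- The kernel after distributing the degenerate triples over the proper ones (10 points). -/
noncomputable def H (u v t : ℝ) : ℝ :=
  K u v t + (K 1 u u + K u 1 u + K u u 1) / 8 + K 1 1 1 / 72

/-- The localizing sum of squares. -/
noncomputable def E (a b c : ℝ) : ℝ :=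
  3 * ((1 - a) + (-11/24) * ((1 - a) * a) + (4/3) * (b * c)) ^ 2
  + 23/192 * ((1 - a) * a + (-224/23) * (b * c)) ^ 2
  + 122/23 * (b * c) ^ 2 + 3 * ((1 - a) * (b - c)) ^ 2

lemma E_nonneg (a b c : ℝ) : 0 ≤ E a b c := by unfold E; positivity

lemma al_sub (a : ℝ) : al (1 / 6 - 5 / 6 * a) = a := by unfold al; ring

lemma H_identity (a b c : ℝ) :
    H (1 / 6 - 5 / 6 * a) (1 / 6 - 5 / 6 * b) (1 / 6 - 5 / 6 * c)
    + H (1 / 6 - 5 / 6 * a) (1 / 6 - 5 / 6 * c) (1 / 6 - 5 / 6 * b)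
    + H (1 / 6 - 5 / 6 * b) (1 / 6 - 5 / 6 * a) (1 / 6 - 5 / 6 * c)
    + H (1 / 6 - 5 / 6 * b) (1 / 6 - 5 / 6 * c) (1 / 6 - 5 / 6 * a)
    + H (1 / 6 - 5 / 6 * c) (1 / 6 - 5 / 6 * a) (1 / 6 - 5 / 6 * b)
    + H (1 / 6 - 5 / 6 * c) (1 / 6 - 5 / 6 * b) (1 / 6 - 5 / 6 * a)
    = - (2 * (a * E a b c + b * E b c a + c * E c a b) + 6 * (a * b * c)) := by
  have h1 : al 1 = -1 := by unfold al; norm_num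
  simp only [H, K, g1, g2, g3, g4, g5, al_sub, h1, E]
  ring

lemma H_neg (u v t : ℝ) (hu : u < 1 / 6) (hv : v < 1 / 6) (ht : t < 1 / 6) :
    H u v t + H u t v + H v u t + H v t u + H t u v + H t v u < 0 := by
  have e : ∀ w : ℝ, w = 1 / 6 - 5 / 6 * al w := by intro w; unfold al; ring
  have p : ∀ w : ℝ, w < 1 / 6 → 0 < al w := by intro w hw; unfold al; linarith
  have key := H_identity (al u) (al v) (al t)
  rw [← e u, ← e v, ← e t] at key
  rw [key]
  have := p u hu
  have := p v hv
  have := p t ht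
  have h1 := mul_nonneg (p u hu).le (E_nonneg (al u) (al v) (al t))
  have h2 := mul_nonneg (p v hv).le (E_nonneg (al v) (al t) (al u))
  have h3 := mul_nonneg (p t ht).le (E_nonneg (al t) (al u) (al v))
  have h4 : 0 < al u * al v * al t := by positivity
  linarith

section sums
variable {α : Type*} [DecidableEq α]

/-- Sum over ordered triples of distinct elements. -/
def S (C : Finset α) (f : α → α → α → ℝ) : ℝ :=
  ∑ x ∈ C, ∑ y ∈ C.erase x, ∑ z ∈ (C.erase x).erase y, f x y z

lemma S_swap_yz (C : Finset α) (f : α → α → α → ℝ) :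
    S C f = S C (fun x y z => f x z y) := by
  unfold S
  refine Finset.sum_congr rfl fun x _ => ?_
  apply Finset.sum_comm'
  intro y z
  simp only [Finset.mem_erase]
  tauto

lemma S_swap_xy (C : Finset α) (f : α → α → α → ℝ) :
    S C f = S C (fun x y z => f y x z) := by
  unfold S
  rw [Finset.sum_comm' (t' := C) (s' := fun y => C.erase y)]
  · refine Finset.sum_congr rfl fun x _ => Finset.sum_congr rfl fun y _ => ?_
    rw [Finset.erase_right_comm]
  · intro y z
    simp only [Finset.mem_erase]
    tauto

lemma S_add (C : Finset α) (f g : α → α → α → ℝ) :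
    S C (fun x y z => f x y z + g x y z) = S C f + S C g := by
  unfold S
  simp only [Finset.sum_add_distrib]

lemma sum_eq_S (C : Finset α) (hC : C.card = 10) (f : α → α → α → ℝ) :
    ∑ x ∈ C, ∑ y ∈ C, ∑ z ∈ C, f x y z
      = S C (fun x y z => f x y z + (f x x y + f x y x + f x y y) / 8 + f x x x / 72) := by
  unfold S
  refine Finset.sum_congr rfl fun x hx => ?_
  have c9 : (C.erase x).card = 9 := by rw [Finset.card_erase_of_mem hx, hC]
  have inner : ∀ y ∈ C.erase x, ∑ z ∈ (C.erase x).erase y,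
      (f x y z + (f x x y + f x y x + f x y y) / 8 + f x x x / 72)
      = ∑ z ∈ C, f x y z + f x x y + f x x x / 9 := by
    intro y hy
    have c8 : ((C.erase x).erase y).card = 8 := by rw [Finset.card_erase_of_mem hy, c9]
    rw [Finset.sum_add_distrib, Finset.sum_add_distrib, Finset.sum_const, Finset.sum_const, c8,
      ← Finset.add_sum_erase C _ hx, ← Finset.add_sum_erase (C.erase x) _ hy]
    simp only [nsmul_eq_mul]
    push_cast
    ring
  rw [Finset.sum_congr rfl inner, Finset.sum_add_distrib, Finset.sum_add_distrib,
    Finset.sum_const, c9, ← Finset.add_sum_erase C _ hx, ← Finset.add_sum_erase C (f x x) hx]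
  simp only [nsmul_eq_mul]
  push_cast
  ring

lemma sq_sum_nonneg {α : Type*} (C : Finset α) (h : α → ℝ) : 0 ≤ ∑ y ∈ C, ∑ z ∈ C, h y * h z := by
  rw [← Finset.sum_mul_sum]
  exact mul_self_nonneg _

end sums

section kernel

abbrev V := EuclideanSpace ℝ (Fin 4)

lemma inner_eq (x y : V) : ⟪x, y⟫ = x 0 * y 0 + x 1 * y 1 + x 2 * y 2 + x 3 * y 3 := by
  simp [PiLp.inner_apply, Fin.sum_univ_four]
  ring

/-- Quaternionic frame of the orthogonal complement of `x`. -/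
def p1 (x y : V) : ℝ := - x 1 * y 0 + x 0 * y 1 - x 3 * y 2 + x 2 * y 3
def p2 (x y : V) : ℝ := - x 2 * y 0 + x 3 * y 1 + x 0 * y 2 - x 1 * y 3
def p3 (x y : V) : ℝ := - x 3 * y 0 - x 2 * y 1 + x 1 * y 2 + x 0 * y 3

lemma frame (x y z : V) (hx : ⟪x, x⟫ = 1) :
    ⟪y, z⟫ - ⟪x, y⟫ * ⟪x, z⟫ = p1 x y * p1 x z + p2 x y * p2 x z + p3 x y * p3 x z := by
  have : ⟪y, z⟫ = ⟪x, x⟫ * ⟪y, z⟫ := by rw [hx, one_mul]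
  rw [this]
  simp only [inner_eq, p1, p2, p3]
  ring

lemma T1 (C : Finset V) (x : V) (hx : ⟪x, x⟫ = 1) (g : ℝ → ℝ) :
    0 ≤ ∑ y ∈ C, ∑ z ∈ C, g ⟪x, y⟫ * g ⟪x, z⟫ * (⟪y, z⟫ - ⟪x, y⟫ * ⟪x, z⟫) := by
  have e : ∀ y z : V, g ⟪x, y⟫ * g ⟪x, z⟫ * (⟪y, z⟫ - ⟪x, y⟫ * ⟪x, z⟫)
      = (g ⟪x, y⟫ * p1 x y) * (g ⟪x, z⟫ * p1 x z) + (g ⟪x, y⟫ * p2 x y) * (g ⟪x, z⟫ * p2 x z)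
        + (g ⟪x, y⟫ * p3 x y) * (g ⟪x, z⟫ * p3 x z) := by
    intro y z
    rw [frame x y z hx]
    ring
  simp only [e, Finset.sum_add_distrib]
  have h1 := sq_sum_nonneg C (fun y => g ⟪x, y⟫ * p1 x y)
  have h2 := sq_sum_nonneg C (fun y => g ⟪x, y⟫ * p2 x y)
  have h3 := sq_sum_nonneg C (fun y => g ⟪x, y⟫ * p3 x y)
  linarith

lemma T2 (C : Finset V) (hC : ∀ y ∈ C, ⟪y, y⟫ = (1 : ℝ)) (x : V) (hx : ⟪x, x⟫ = 1) :
    0 ≤ ∑ y ∈ C, ∑ z ∈ C,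
      (3 * (⟪y, z⟫ - ⟪x, y⟫ * ⟪x, z⟫) ^ 2 - (1 - ⟪x, y⟫ ^ 2) * (1 - ⟪x, z⟫ ^ 2)) := by
  have n : ∀ y ∈ C, 1 - ⟪x, y⟫ ^ 2 = p1 x y ^ 2 + p2 x y ^ 2 + p3 x y ^ 2 := by
    intro y hy
    have := frame x y y hx
    rw [hC y hy] at this
    linear_combination this
  have e : ∀ y ∈ C, ∀ z ∈ C,
      3 * (⟪y, z⟫ - ⟪x, y⟫ * ⟪x, z⟫) ^ 2 - (1 - ⟪x, y⟫ ^ 2) * (1 - ⟪x, z⟫ ^ 2)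
      = 6 * ((p1 x y * p2 x y) * (p1 x z * p2 x z)) + 6 * ((p1 x y * p3 x y) * (p1 x z * p3 x z))
        + 6 * ((p2 x y * p3 x y) * (p2 x z * p3 x z))
        + (p1 x y ^ 2 - p2 x y ^ 2) * (p1 x z ^ 2 - p2 x z ^ 2)
        + (p1 x y ^ 2 - p3 x y ^ 2) * (p1 x z ^ 2 - p3 x z ^ 2)
        + (p2 x y ^ 2 - p3 x y ^ 2) * (p2 x z ^ 2 - p3 x z ^ 2) := by
    intro y hy z hz
    rw [frame x y z hx, n y hy, n z hz]
    ring
  rw [Finset.sum_congr rfl fun y hy => Finset.sum_congr rfl fun z hz => e y hy z hz]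
  simp only [Finset.sum_add_distrib, ← Finset.mul_sum]
  have h1 := sq_sum_nonneg C (fun y => p1 x y * p2 x y)
  have h2 := sq_sum_nonneg C (fun y => p1 x y * p3 x y)
  have h3 := sq_sum_nonneg C (fun y => p2 x y * p3 x y)
  have h4 := sq_sum_nonneg C (fun y => p1 x y ^ 2 - p2 x y ^ 2)
  have h5 := sq_sum_nonneg C (fun y => p1 x y ^ 2 - p3 x y ^ 2)
  have h6 := sq_sum_nonneg C (fun y => p2 x y ^ 2 - p3 x y ^ 2)
  simp only [← Finset.mul_sum] at h1 h2 h3 h4 h5 h6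
  linarith

lemma K_sum_nonneg (C : Finset V) (hC : ∀ y ∈ C, ⟪y, y⟫ = (1 : ℝ)) (x : V) (hx : ⟪x, x⟫ = 1) :
    0 ≤ ∑ y ∈ C, ∑ z ∈ C, K ⟪x, y⟫ ⟪x, z⟫ ⟪y, z⟫ := by
  have a1 := mul_nonneg (show (0 : ℝ) ≤ 1691/900 by norm_num) (sq_sum_nonneg C (fun y => g1 ⟪x, y⟫))
  have a2 := mul_nonneg (show (0 : ℝ) ≤ 38279/6764 by norm_num)
    (sq_sum_nonneg C (fun y => g2 ⟪x, y⟫))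
  have a3 := mul_nonneg (show (0 : ℝ) ≤ 334886/114837 by norm_num)
    (sq_sum_nonneg C (fun y => g3 ⟪x, y⟫))
  have a4 := mul_nonneg (show (0 : ℝ) ≤ 87/5 by norm_num) (T1 C x hx g4)
  have a5 := mul_nonneg (show (0 : ℝ) ≤ 3816/145 by norm_num) (T1 C x hx g5)
  have a6 := mul_nonneg (show (0 : ℝ) ≤ 414/125 by norm_num) (T2 C hC x hx)
  have := add_nonneg (add_nonneg (add_nonneg (add_nonneg (add_nonneg a1 a2) a3) a4) a5) a6
  refine this.trans_eq ?_
  simp only [Finset.mul_sum, ← Finset.sum_add_distrib]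
  rfl

end kernel

end Petersen

open Petersen in
theorem petersen_optimal
    (C : Finset (EuclideanSpace ℝ (Fin 4)))
    (hunit : ∀ c ∈ C, ‖c‖ = 1)
    (hcard : C.card = 10) :
    ∃ c ∈ C, ∃ c' ∈ C, c ≠ c' ∧ (1 / 6 : ℝ) ≤ ⟪c, c'⟫ := by
  classical
  by_contra hcon
  push Not at hcon
  have hC : ∀ y ∈ C, ⟪y, y⟫ = (1 : ℝ) := by
    intro y hy
    rw [real_inner_self_eq_norm_sq, hunit y hy, one_pow]
  have h0 : 0 ≤ ∑ x ∈ C, ∑ y ∈ C, ∑ z ∈ C, K ⟪x, y⟫ ⟪x, z⟫ ⟪y, z⟫ :=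
    Finset.sum_nonneg fun x hx => K_sum_nonneg C hC x (hC x hx)
  rw [sum_eq_S C hcard (fun x y z => K ⟪x, y⟫ ⟪x, z⟫ ⟪y, z⟫)] at h0
  have h1 : 0 ≤ S C (fun x y z => H ⟪x, y⟫ ⟪x, z⟫ ⟪y, z⟫) := by
    refine h0.trans_eq ?_
    unfold S
    refine Finset.sum_congr rfl fun x hx => Finset.sum_congr rfl fun y hy =>
      Finset.sum_congr rfl fun z hz => ?_
    have hy' := Finset.mem_of_mem_erase hy
    simp only [H, hC x hx, hC y hy', real_inner_comm x y]
  -- the six permutations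
  have s1 := S_swap_yz C (fun x y z => H ⟪x, y⟫ ⟪x, z⟫ ⟪y, z⟫)
  have s2 := S_swap_xy C (fun x y z => H ⟪x, y⟫ ⟪x, z⟫ ⟪y, z⟫)
  have s3 := S_swap_xy C (fun x y z => H ⟪x, z⟫ ⟪x, y⟫ ⟪z, y⟫)
  have s4 := S_swap_yz C (fun x y z => H ⟪y, x⟫ ⟪y, z⟫ ⟪x, z⟫)
  have s5 := S_swap_yz C (fun x y z => H ⟪y, z⟫ ⟪y, x⟫ ⟪z, x⟫)
  have key : S C (fun x y z => H ⟪x, y⟫ ⟪x, z⟫ ⟪y, z⟫ + H ⟪x, z⟫ ⟪x, y⟫ ⟪z, y⟫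
      + H ⟪y, x⟫ ⟪y, z⟫ ⟪x, z⟫ + H ⟪y, z⟫ ⟪y, x⟫ ⟪z, x⟫ + H ⟪z, x⟫ ⟪z, y⟫ ⟪x, y⟫
      + H ⟪z, y⟫ ⟪z, x⟫ ⟪y, x⟫) < 0 := by
    unfold S
    have ne : C.Nonempty := Finset.card_pos.mp (by omega)
    refine Finset.sum_neg (fun x hx => ?_) ne
    have c9 : (C.erase x).card = 9 := by rw [Finset.card_erase_of_mem hx, hcard]
    refine Finset.sum_neg (fun y hy => ?_) (Finset.card_pos.mp (by omega))
    have c8 : ((C.erase x).erase y).card = 8 := by rw [Finset.card_erase_of_mem hy, c9]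
    refine Finset.sum_neg (fun z hz => ?_) (Finset.card_pos.mp (by omega))
    simp only [Finset.mem_erase] at hy hz
    have hn := H_neg ⟪x, y⟫ ⟪x, z⟫ ⟪y, z⟫ (hcon x hx y hy.2 (Ne.symm hy.1))
      (hcon x hx z hz.2.2 (Ne.symm hz.2.1)) (hcon y hy.2 z hz.2.2 (Ne.symm hz.1))
    beta_reduce
    rw [real_inner_comm x y, real_inner_comm x z, real_inner_comm y z]
    linarith
  rw [S_add, S_add, S_add, S_add, S_add] at key
  linarith
end

section
/- There do not exist an integer d ≥ 1 and real numbers f₀ > 0 and f₁, …, f_d ≥ 0 such that the polynomial F(x) = f₀ + Σ_{k=1}^d f_k · U_k(x)/(k+1) satisfies both F(x) ≤ 0 for all x ∈ [−1, 1/6] and F(1) = 10·f₀. (Hence linear programming bounds cannot prove that the Petersen code is an optimal (4,10,1/6) spherical code.) -/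
open Polynomial Polynomial.Chebyshev in
lemma petersen_rec (x : ℝ) (n : ℕ) :
    (U ℝ ((n + 2 : ℕ) : ℤ)).eval x
      = 2 * x * (U ℝ ((n + 1 : ℕ) : ℤ)).eval x - (U ℝ (n : ℤ)).eval x := by
  have := congrArg (Polynomial.eval x) (U_add_two ℝ (n : ℤ))
  push_cast
  simpa using this

open Polynomial Polynomial.Chebyshev in
lemma petersen_inv (x : ℝ) (n : ℕ) :
    (U ℝ (n : ℤ)).eval x ^ 2 - 2 * x * (U ℝ (n : ℤ)).eval x * (U ℝ ((n + 1 : ℕ) : ℤ)).eval x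
      + (U ℝ ((n + 1 : ℕ) : ℤ)).eval x ^ 2 = 1 := by
  induction n with
  | zero => simp; ring
  | succ n ih =>
    rw [show n + 1 + 1 = n + 2 from rfl, petersen_rec]
    linarith

open Polynomial Polynomial.Chebyshev in
lemma petersen_bound (x : ℝ) (n : ℕ) :
    (1 - x ^ 2) * (U ℝ (n : ℤ)).eval x ^ 2 ≤ 1 := by
  nlinarith [petersen_inv x n,
    sq_nonneg ((U ℝ ((n + 1 : ℕ) : ℤ)).eval x - x * (U ℝ (n : ℤ)).eval x)]

open Polynomial Polynomial.Chebyshev in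
lemma petersen_neg_one (n : ℕ) : -((n : ℝ) + 1) ≤ (U ℝ (n : ℤ)).eval (-1) := by
  have hn : (0 : ℝ) ≤ n := Nat.cast_nonneg n
  have h := U_eval_neg ℝ n 1
  rw [h, U_eval_one]
  rcases Int.even_or_odd (n : ℤ) with h | h
  · simp [Int.negOnePow_even _ h]; linarith
  · simp [Int.negOnePow_odd _ h]

open Polynomial Polynomial.Chebyshev in
lemma petersen_moment (k : ℕ) (hk : 1 ≤ k) :
    0 ≤ ((k : ℝ) + 1) + 6.0264 * (U ℝ (k : ℤ)).eval (1 / 6)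
      + 2.9916 * (U ℝ (k : ℤ)).eval (-2 / 3) + 0.01 * (U ℝ (k : ℤ)).eval (-1) := by
  by_cases h10 : 10 ≤ k
  · have h1 := petersen_bound (1 / 6) k
    have h2 := petersen_bound (-2 / 3) k
    have h3 := petersen_neg_one k
    have hk' : (10 : ℝ) ≤ k := by exact_mod_cast h10
    have h1' : -1.02 ≤ (U ℝ (k : ℤ)).eval (1 / 6) := by
      by_contra! h; nlinarith
    have h2' : -1.35 ≤ (U ℝ (k : ℤ)).eval (-2 / 3) := by
      by_contra! h; nlinarith
    linarith
  · have e0 : ∀ x : ℝ, (U ℝ ((0 : ℕ) : ℤ)).eval x = 1 := by intro x; simp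
    have e1 : ∀ x : ℝ, (U ℝ ((1 : ℕ) : ℤ)).eval x = 2 * x := by intro x; simp
    have e2 := fun x => petersen_rec x 0
    have e3 := fun x => petersen_rec x 1
    have e4 := fun x => petersen_rec x 2
    have e5 := fun x => petersen_rec x 3
    have e6 := fun x => petersen_rec x 4
    have e7 := fun x => petersen_rec x 5
    have e8 := fun x => petersen_rec x 6
    have e9 := fun x => petersen_rec x 7
    simp only [Nat.reduceAdd, e0, e1] at e2
    simp only [Nat.reduceAdd, e1, e2] at e3
    simp only [Nat.reduceAdd, e2, e3] at e4
    simp only [Nat.reduceAdd, e3, e4] at e5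
    simp only [Nat.reduceAdd, e4, e5] at e6
    simp only [Nat.reduceAdd, e5, e6] at e7
    simp only [Nat.reduceAdd, e6, e7] at e8
    simp only [Nat.reduceAdd, e7, e8] at e9
    push Not at h10
    interval_cases k
    · rw [e1, e1, e1]; norm_num
    · rw [e2, e2, e2]; norm_num
    · rw [e3, e3, e3]; norm_num
    · rw [e4, e4, e4]; norm_num
    · rw [e5, e5, e5]; norm_num
    · rw [e6, e6, e6]; norm_num
    · rw [e7, e7, e7]; norm_num
    · rw [e8, e8, e8]; norm_num
    · rw [e9, e9, e9]; norm_num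

theorem no_tight_lp_bound_for_petersen :
    ¬ ∃ (d : ℕ) (f : ℕ → ℝ), 1 ≤ d ∧ 0 < f 0 ∧
      (∀ k, 1 ≤ k → k ≤ d → 0 ≤ f k) ∧
      (∀ x ∈ Set.Icc (-1 : ℝ) (1 / 6),
        f 0 + ∑ k ∈ Finset.Icc 1 d,
          f k * (Polynomial.Chebyshev.U ℝ (k : ℤ)).eval x / (k + 1) ≤ 0) ∧
      (f 0 + ∑ k ∈ Finset.Icc 1 d,
          f k * (Polynomial.Chebyshev.U ℝ (k : ℤ)).eval 1 / (k + 1)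
        = 10 * f 0) := by
  rintro ⟨d, f, -, h0, hf, hF, h1⟩
  have a := hF (1 / 6) (by norm_num)
  have b := hF (-2 / 3) (by norm_num)
  have c := hF (-1) (by norm_num)
  have key : 0 ≤ ∑ k ∈ Finset.Icc 1 d,
      (f k * (Polynomial.Chebyshev.U ℝ (k : ℤ)).eval 1 / (k + 1)
      + 6.0264 * (f k * (Polynomial.Chebyshev.U ℝ (k : ℤ)).eval (1 / 6) / (k + 1))
      + 2.9916 * (f k * (Polynomial.Chebyshev.U ℝ (k : ℤ)).eval (-2 / 3) / (k + 1))
      + 0.01 * (f k * (Polynomial.Chebyshev.U ℝ (k : ℤ)).eval (-1) / (k + 1))) := by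
    apply Finset.sum_nonneg
    intro k hk
    rw [Finset.mem_Icc] at hk
    have hm := petersen_moment k hk.1
    have := div_nonneg (mul_nonneg (hf k hk.1 hk.2) hm) (by positivity : (0 : ℝ) ≤ k + 1)
    rw [Polynomial.Chebyshev.U_eval_one]
    push_cast
    refine this.trans (le_of_eq ?_)
    ring
  simp only [Finset.sum_add_distrib, ← Finset.mul_sum] at key
  linarith
end

section
/- Let C be a 10-element subset of the unit sphere S³ ⊆ ℝ⁴ such that any two distinct points of C have inner product at most 1/6. Then the number of ordered triples (c, c', c'') ∈ C³ with (⟨c,c'⟩, ⟨c,c''⟩, ⟨c',c''⟩) = (−2/3, −2/3, 1/6) equals 60, the number with (⟨c,c'⟩, ⟨c,c''⟩, ⟨c',c''⟩) = (−2/3, 1/6, 1/6) equals 120, and the number with (⟨c,c'⟩, ⟨c,c''⟩, ⟨c',c''⟩) = (1/6, 1/6, 1/6) equals 180; no ordered triple of pairwise distinct points realizes (−2/3, −2/3, −2/3). (This determines the three-point distance distribution α of C: α(−2/3,−2/3,1/6) = 6, α(−2/3,1/6,1/6) = 12, α(1/6,1/6,1/6) = 18, α(−2/3,−2/3,1) =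 3, α(1/6,1/6,1) = 6, α(1,1,1) = 1.) -/
open scoped RealInnerProductSpace

namespace PetersenCode

abbrev E4 := EuclideanSpace ℝ (Fin 4)

/-- The degree-zero part of the three-point certificate. -/
noncomputable def F0 (u v : ℝ) : ℝ :=
  59 / 1296 * (u * v) + 41 / 54 * ((u ^ 2 - 1 / 4) * (v ^ 2 - 1 / 4))
    + (u ^ 3 - 1 / 72) * (v ^ 3 - 1 / 72)
    - 1 / 12 * (u * (v ^ 3 - 1 / 72) + (u ^ 3 - 1 / 72) * v)
    - 1 / 12 * ((u ^ 2 - 1 / 4) * (v ^ 3 - 1 / 72) + (u ^ 3 - 1 / 72) * (v ^ 2 - 1 / 4))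

/-- The three-point kernel of the certificate. -/
noncomputable def F (u v t : ℝ) : ℝ :=
  F0 u v + ((u ^ 2 - u / 3) * (v ^ 2 - v / 3) * (t - u * v)
    + 25 / 72 * ((u - 3 / 25) * (v - 3 / 25) * (t - u * v))
    + 1013 / 32400 * (1 * 1 * (t - u * v)))
    + 25 / 144 * ((t - u * v) ^ 2 - (1 - u ^ 2) * (1 - v ^ 2) / 3)

/-- The symmetrised kernel. -/
noncomputable def Fs (u v t : ℝ) : ℝ := F u v t + F u t v + F v t u

noncomputable def K (u v t : ℝ) : ℝ :=
  (1 / 6 - u) * (((1 / 6 - v) * (1 / 6 - t) - (u + 2 / 3) ^ 2 / 4) ^ 2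
    + (u + 2 / 3) ^ 2 * (v + t - 1 / 3) ^ 2 / 4)

noncomputable def H (u v t : ℝ) : ℝ := K u v t + K v u t + K t u v

lemma certificate (u v t : ℝ) :
    H u v t + Fs u v t + (Fs 1 u u + Fs 1 v v + Fs 1 t t) / 8 + Fs 1 1 1 / 72 = 0 := by
  unfold H K Fs F F0; ring

lemma K_nonneg {u : ℝ} (v t : ℝ) (hu : u ≤ 1 / 6) : 0 ≤ K u v t := by
  unfold K
  apply mul_nonneg (by linarith)
  positivity

lemma K_zero {u v t : ℝ} (hu : u ≤ 1 / 6) (hv : v ≤ 1 / 6) (ht : t ≤ 1 / 6) (h : K u v t = 0) :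
    u = -2 / 3 ∨ u = 1 / 6 := by
  unfold K at h
  rcases mul_eq_zero.mp h with h | h
  · right; linarith
  · have h1 : 0 ≤ ((1 / 6 - v) * (1 / 6 - t) - (u + 2 / 3) ^ 2 / 4) ^ 2 := sq_nonneg _
    have h2 : 0 ≤ (u + 2 / 3) ^ 2 * (v + t - 1 / 3) ^ 2 / 4 := by positivity
    have h3 : ((1 / 6 - v) * (1 / 6 - t) - (u + 2 / 3) ^ 2 / 4) ^ 2 = 0 := by linarith
    have h4 : (u + 2 / 3) ^ 2 * (v + t - 1 / 3) ^ 2 = 0 := by linarith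
    rcases mul_eq_zero.mp h4 with h5 | h5
    · left; have := pow_eq_zero_iff (two_ne_zero) |>.mp h5; linarith
    · left
      have h6 := pow_eq_zero_iff (two_ne_zero) |>.mp h5
      have h7 := pow_eq_zero_iff (two_ne_zero) |>.mp h3
      have h8 : v = 1 / 6 := by linarith
      rw [h8] at h7
      have h9 : (u + 2 / 3) ^ 2 = 0 := by linarith
      have := pow_eq_zero_iff (two_ne_zero) |>.mp h9
      linarith

lemma F0_sum (C : Finset E4) (l : E4 → ℝ) :
    1 / 100 * (∑ y ∈ C, l y) ^ 2 ≤ ∑ y ∈ C, ∑ z ∈ C, F0 (l y) (l z) := by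
  have key : ∑ y ∈ C, ∑ z ∈ C, F0 (l y) (l z) =
      59 / 1296 * ((∑ y ∈ C, l y) * (∑ z ∈ C, l z))
      + 41 / 54 * ((∑ y ∈ C, (l y ^ 2 - 1 / 4)) * (∑ z ∈ C, (l z ^ 2 - 1 / 4)))
      + (∑ y ∈ C, (l y ^ 3 - 1 / 72)) * (∑ z ∈ C, (l z ^ 3 - 1 / 72))
      - 1 / 12 * ((∑ y ∈ C, l y) * (∑ z ∈ C, (l z ^ 3 - 1 / 72))
        + (∑ y ∈ C, (l y ^ 3 - 1 / 72)) * (∑ z ∈ C, l z))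
      - 1 / 12 * ((∑ y ∈ C, (l y ^ 2 - 1 / 4)) * (∑ z ∈ C, (l z ^ 3 - 1 / 72))
        + (∑ y ∈ C, (l y ^ 3 - 1 / 72)) * (∑ z ∈ C, (l z ^ 2 - 1 / 4))) := by
    simp only [Finset.sum_mul_sum, F0]
    simp only [Finset.sum_add_distrib, Finset.sum_sub_distrib, ← Finset.mul_sum]
  rw [key]
  generalize (∑ y ∈ C, l y) = a
  generalize (∑ y ∈ C, (l y ^ 2 - 1 / 4)) = b
  generalize (∑ y ∈ C, (l y ^ 3 - 1 / 72)) = c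
  nlinarith [sq_nonneg (c - a / 12 - b / 12), sq_nonneg a, sq_nonneg b, sq_nonneg (a - b)]

lemma F1_sum (C : Finset E4) (x : E4) (hx : ‖x‖ = 1) (l : E4 → ℝ) :
    0 ≤ ∑ y ∈ C, ∑ z ∈ C, l y * l z * (⟪y, z⟫ - ⟪x, y⟫ * ⟪x, z⟫) := by
  have h : ∑ y ∈ C, ∑ z ∈ C, l y * l z * (⟪y, z⟫ - ⟪x, y⟫ * ⟪x, z⟫)
      = ⟪∑ y ∈ C, l y • (y - ⟪x, y⟫ • x), ∑ z ∈ C, l z • (z - ⟪x, z⟫ • x)⟫ := by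
    rw [sum_inner]
    refine Finset.sum_congr rfl fun y _ => ?_
    rw [inner_sum]
    refine Finset.sum_congr rfl fun z _ => ?_
    simp only [inner_smul_left, inner_smul_right, inner_sub_left, inner_sub_right,
      real_inner_self_eq_norm_sq, hx, real_inner_comm x y]
    simp
    ring
  rw [h]
  exact real_inner_self_nonneg

lemma tensor (w w' x : Fin 4 → ℝ) (p q : ℝ) :
    ∑ a, ∑ b, (w a * w b - p * ((if a = b then 1 else 0) - x a * x b)) *
      (w' a * w' b - q * ((if a = b then 1 else 0) - x a * x b))
    = (∑ a, w a * w' a) ^ 2 - q * ((∑ a, w a * w a) - (∑ a, w a * x a) ^ 2)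
      - p * ((∑ a, w' a * w' a) - (∑ a, w' a * x a) ^ 2)
      + p * q * (4 - 2 * (∑ a, x a * x a) + (∑ a, x a * x a) ^ 2) := by
  simp [Fin.sum_univ_four]
  ring

lemma F2_sum (C : Finset E4) (x : E4) (hx : ‖x‖ = 1) (hC : ∀ y ∈ C, ‖y‖ = 1) :
    0 ≤ ∑ y ∈ C, ∑ z ∈ C,
      ((⟪y, z⟫ - ⟪x, y⟫ * ⟪x, z⟫) ^ 2 - (1 - ⟪x, y⟫ ^ 2) * (1 - ⟪x, z⟫ ^ 2) / 3) := by
  let w : E4 → Fin 4 → ℝ := fun y a => y a - ⟪x, y⟫ * x a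
  let m : E4 → Fin 4 → Fin 4 → ℝ := fun y a b =>
    w y a * w y b - (1 - ⟪x, y⟫ ^ 2) / 3 * ((if a = b then 1 else 0) - x a * x b)
  have inn : ∀ y z : E4, ⟪y, z⟫ = ∑ a, y a * z a := by
    intro y z
    rw [PiLp.inner_apply]
    refine Finset.sum_congr rfl fun a _ => ?_
    simp [mul_comm]
  have hxx : ∑ a, x a * x a = 1 := by rw [← inn, real_inner_self_eq_norm_sq, hx]; norm_num
  have hww : ∀ y z : E4, ∑ a, w y a * w z a = ⟪y, z⟫ - ⟪x, y⟫ * ⟪x, z⟫ := by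
    intro y z
    have : ∑ a, w y a * w z a = (∑ a, y a * z a) - ⟪x, z⟫ * (∑ a, x a * y a)
        - ⟪x, y⟫ * (∑ a, x a * z a) + ⟪x, y⟫ * ⟪x, z⟫ * ∑ a, x a * x a := by
      simp only [Finset.mul_sum, ← Finset.sum_add_distrib, ← Finset.sum_sub_distrib]
      refine Finset.sum_congr rfl fun a _ => ?_
      simp only [w]; ring
    rw [this, hxx, ← inn, ← inn, ← inn]; ring
  have hwx : ∀ y : E4, ∑ a, w y a * x a = 0 := by
    intro y
    have : ∑ a, w y a * x a = (∑ a, x a * y a) - ⟪x, y⟫ * ∑ a, x a * x a := by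
      simp only [Finset.mul_sum, ← Finset.sum_sub_distrib]
      refine Finset.sum_congr rfl fun a _ => ?_
      simp only [w]; ring
    rw [this, hxx, ← inn]; ring
  have hm : ∀ y ∈ C, ∀ z ∈ C, (⟪y, z⟫ - ⟪x, y⟫ * ⟪x, z⟫) ^ 2
      - (1 - ⟪x, y⟫ ^ 2) * (1 - ⟪x, z⟫ ^ 2) / 3 = ∑ a, ∑ b, m y a b * m z a b := by
    intro y hy z hz
    simp only [m]
    rw [tensor, hww, hww, hww, hwx, hwx, hxx, real_inner_self_eq_norm_sq,
      real_inner_self_eq_norm_sq, hC y hy, hC z hz]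
    ring
  have : ∑ y ∈ C, ∑ z ∈ C,
      ((⟪y, z⟫ - ⟪x, y⟫ * ⟪x, z⟫) ^ 2 - (1 - ⟪x, y⟫ ^ 2) * (1 - ⟪x, z⟫ ^ 2) / 3)
      = ∑ a, ∑ b, (∑ y ∈ C, m y a b) ^ 2 := by
    rw [Finset.sum_congr rfl fun y hy => Finset.sum_congr rfl fun z hz => hm y hy z hz]
    simp only [sq, Finset.sum_mul_sum]
    rw [Finset.sum_congr rfl fun y _ => Finset.sum_comm]
    rw [Finset.sum_comm]
    refine Finset.sum_congr rfl fun a _ => ?_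
    rw [Finset.sum_congr rfl fun y _ => Finset.sum_comm]
    rw [Finset.sum_comm]
  rw [this]
  positivity

lemma F_sum (C : Finset E4) (x : E4) (hx : ‖x‖ = 1) (hC : ∀ y ∈ C, ‖y‖ = 1) :
    1 / 100 * (∑ y ∈ C, ⟪x, y⟫) ^ 2 ≤ ∑ y ∈ C, ∑ z ∈ C, F ⟪x, y⟫ ⟪x, z⟫ ⟪y, z⟫ := by
  have h0 := F0_sum C (fun y => ⟪x, y⟫)
  have h1 := F1_sum C x hx (fun y => ⟪x, y⟫ ^ 2 - ⟪x, y⟫ / 3)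
  have h2 := F1_sum C x hx (fun y => ⟪x, y⟫ - 3 / 25)
  have h3 := F1_sum C x hx (fun y => 1)
  have h4 := F2_sum C x hx hC
  simp only [one_mul] at h3
  simp only [F, Finset.sum_add_distrib, ← Finset.mul_sum, one_mul]
  linarith

lemma split (C : Finset E4) (f : E4 → E4 → E4 → ℝ) :
    ∑ x ∈ C, ∑ y ∈ C, ∑ z ∈ C, f x y z =
      ∑ x ∈ C, ∑ y ∈ C.erase x, ∑ z ∈ (C.erase x).erase y, f x y z
      + ∑ x ∈ C, ∑ y ∈ C.erase x, (f x x y + f x y x + f x y y) + ∑ x ∈ C, f x x x := by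
  rw [← Finset.sum_add_distrib, ← Finset.sum_add_distrib]
  refine Finset.sum_congr rfl fun x hx => ?_
  have h1 : ∀ y ∈ C.erase x, ∑ z ∈ C, f x y z =
      ∑ z ∈ (C.erase x).erase y, f x y z + (f x y x + f x y y) := by
    intro y hy
    rw [← Finset.add_sum_erase C _ hx, ← Finset.add_sum_erase (C.erase x) _ hy]
    ring
  rw [← Finset.add_sum_erase C _ hx, Finset.sum_congr rfl h1, ← Finset.add_sum_erase C _ hx]
  simp only [Finset.sum_add_distrib]
  ring

lemma main_ineq (C : Finset E4) (hcard : C.card = 10) (hunit : ∀ c ∈ C, ‖c‖ = 1) :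
    ∑ x ∈ C, ∑ y ∈ C.erase x, ∑ z ∈ (C.erase x).erase y, H ⟪x, y⟫ ⟪x, z⟫ ⟪y, z⟫
      + 3 / 100 * ∑ x ∈ C, (∑ y ∈ C, ⟪x, y⟫) ^ 2 ≤ 0 := by
  have hone : ∀ x ∈ C, ⟪x, x⟫ = (1 : ℝ) := fun x hx => by
    rw [real_inner_self_eq_norm_sq, hunit x hx]; norm_num
  have hF : 1 / 100 * ∑ x ∈ C, (∑ y ∈ C, ⟪x, y⟫) ^ 2
      ≤ ∑ x ∈ C, ∑ y ∈ C, ∑ z ∈ C, F ⟪x, y⟫ ⟪x, z⟫ ⟪y, z⟫ := by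
    rw [Finset.mul_sum]
    exact Finset.sum_le_sum fun x hx => F_sum C x (hunit x hx) hunit
  have hFs : ∑ x ∈ C, ∑ y ∈ C, ∑ z ∈ C, Fs ⟪x, y⟫ ⟪x, z⟫ ⟪y, z⟫
      = 3 * ∑ x ∈ C, ∑ y ∈ C, ∑ z ∈ C, F ⟪x, y⟫ ⟪x, z⟫ ⟪y, z⟫ := by
    have e1 : ∑ x ∈ C, ∑ y ∈ C, ∑ z ∈ C, F ⟪x, y⟫ ⟪y, z⟫ ⟪x, z⟫
        = ∑ x ∈ C, ∑ y ∈ C, ∑ z ∈ C, F ⟪x, y⟫ ⟪x, z⟫ ⟪y, z⟫ := by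
      rw [Finset.sum_comm]
      refine Finset.sum_congr rfl fun x _ => Finset.sum_congr rfl fun y _ =>
        Finset.sum_congr rfl fun z _ => ?_
      rw [real_inner_comm]
    have e2 : ∑ x ∈ C, ∑ y ∈ C, ∑ z ∈ C, F ⟪x, z⟫ ⟪y, z⟫ ⟪x, y⟫
        = ∑ x ∈ C, ∑ y ∈ C, ∑ z ∈ C, F ⟪x, y⟫ ⟪x, z⟫ ⟪y, z⟫ := by
      rw [Finset.sum_congr rfl fun x _ => Finset.sum_comm, Finset.sum_comm]
      refine Finset.sum_congr rfl fun x _ => Finset.sum_congr rfl fun y _ =>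
        Finset.sum_congr rfl fun z _ => ?_
      rw [real_inner_comm x y, real_inner_comm x z]
    simp only [Fs, Finset.sum_add_distrib]
    rw [e1, e2]; ring
  have hH : ∀ u v t : ℝ, H u v t = -1 * Fs u v t + (-1 / 8) * Fs 1 u u + (-1 / 8) * Fs 1 v v
      + (-1 / 8) * Fs 1 t t + (-1 / 72) * Fs 1 1 1 := by
    intro u v t
    have := certificate u v t
    linarith
  have hsplit := split C (fun x y z => H ⟪x, y⟫ ⟪x, z⟫ ⟪y, z⟫)
  have hdiag : ∑ x ∈ C, H ⟪x, x⟫ ⟪x, x⟫ ⟪x, x⟫ = 10 * H 1 1 1 := by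
    rw [Finset.sum_congr rfl fun x hx => by rw [hone x hx]]
    simp [hcard]
  have hpair : ∑ x ∈ C, ∑ y ∈ C.erase x, (H ⟪x, x⟫ ⟪x, y⟫ ⟪x, y⟫ + H ⟪x, y⟫ ⟪x, x⟫ ⟪y, x⟫
      + H ⟪x, y⟫ ⟪x, y⟫ ⟪y, y⟫) = (∑ x ∈ C, ∑ y ∈ C, 3 * H 1 ⟪x, y⟫ ⟪x, y⟫) - 30 * H 1 1 1 := by
    have : (30 : ℝ) * H 1 1 1 = ∑ x ∈ C, 3 * H 1 1 1 := by simp [hcard]; ring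
    rw [this, ← Finset.sum_sub_distrib]
    refine Finset.sum_congr rfl fun x hx => ?_
    rw [← Finset.add_sum_erase C (fun y => 3 * H 1 ⟪x, y⟫ ⟪x, y⟫) hx, hone x hx,
      add_sub_cancel_left]
    refine Finset.sum_congr rfl fun y hy => ?_
    rw [hone y (Finset.mem_of_mem_erase hy), real_inner_comm x y]
    unfold H K; ring
  rw [hdiag, hpair] at hsplit
  generalize ∑ x ∈ C, ∑ y ∈ C.erase x, ∑ z ∈ (C.erase x).erase y, H ⟪x, y⟫ ⟪x, z⟫ ⟪y, z⟫ = T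
    at hsplit ⊢
  simp only [hH, Finset.sum_add_distrib, ← Finset.mul_sum] at hsplit
  have s1 : ∑ x ∈ C, ∑ y ∈ C, ∑ z ∈ C, Fs 1 ⟪x, y⟫ ⟪x, y⟫
      = 10 * ∑ x ∈ C, ∑ y ∈ C, Fs 1 ⟪x, y⟫ ⟪x, y⟫ := by
    simp [hcard, Finset.mul_sum]
  have s2 : ∑ x ∈ C, ∑ y ∈ C, ∑ z ∈ C, Fs 1 ⟪x, z⟫ ⟪x, z⟫
      = 10 * ∑ x ∈ C, ∑ y ∈ C, Fs 1 ⟪x, y⟫ ⟪x, y⟫ := by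
    simp [hcard, Finset.mul_sum]
  have s3 : ∑ x ∈ C, ∑ y ∈ C, ∑ z ∈ C, Fs 1 ⟪y, z⟫ ⟪y, z⟫
      = 10 * ∑ x ∈ C, ∑ y ∈ C, Fs 1 ⟪x, y⟫ ⟪x, y⟫ := by
    simp [hcard, Finset.mul_sum]
  rw [s1, s2, s3, hFs] at hsplit
  simp only [Finset.sum_const, hcard, nsmul_eq_mul] at hsplit
  push_cast at hsplit
  linarith

lemma consequence (C : Finset E4) (hcard : C.card = 10) (hunit : ∀ c ∈ C, ‖c‖ = 1)
    (hinner : ∀ c ∈ C, ∀ c' ∈ C, c ≠ c' → ⟪c, c'⟫ ≤ (1 / 6 : ℝ)) :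
    (∀ x ∈ C, ∀ y ∈ C, x ≠ y → ⟪x, y⟫ = (-2 / 3 : ℝ) ∨ ⟪x, y⟫ = (1 / 6 : ℝ)) ∧
    ∀ x ∈ C, ∑ y ∈ C, ⟪x, y⟫ = (0 : ℝ) := by
  have hmain := main_ineq C hcard hunit
  have hz : ∀ x ∈ C, ∀ y ∈ C.erase x, ∀ z ∈ (C.erase x).erase y,
      0 ≤ K ⟪x, y⟫ ⟪x, z⟫ ⟪y, z⟫ ∧ 0 ≤ H ⟪x, y⟫ ⟪x, z⟫ ⟪y, z⟫
        ∧ K ⟪x, y⟫ ⟪x, z⟫ ⟪y, z⟫ ≤ H ⟪x, y⟫ ⟪x, z⟫ ⟪y, z⟫ := by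
    intro x hx y hy z hz
    simp only [Finset.mem_erase] at hy hz
    have h1 := K_nonneg ⟪x, z⟫ ⟪y, z⟫ (hinner x hx y hy.2 hy.1.symm)
    have h2 := K_nonneg ⟪x, y⟫ ⟪y, z⟫ (hinner x hx z hz.2.2 hz.2.1.symm)
    have h3 := K_nonneg ⟪x, y⟫ ⟪x, z⟫ (hinner y hy.2 z hz.2.2 hz.1.symm)
    refine ⟨h1, ?_, ?_⟩ <;> unfold H <;> linarith
  have n1 : 0 ≤ ∑ x ∈ C, ∑ y ∈ C.erase x, ∑ z ∈ (C.erase x).erase y,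
      H ⟪x, y⟫ ⟪x, z⟫ ⟪y, z⟫ :=
    Finset.sum_nonneg fun x hx => Finset.sum_nonneg fun y hy => Finset.sum_nonneg fun z hz' =>
      (hz x hx y hy z hz').2.1
  have n2 : 0 ≤ ∑ x ∈ C, (∑ y ∈ C, ⟪x, y⟫ : ℝ) ^ 2 := Finset.sum_nonneg fun x _ => sq_nonneg _
  constructor
  · intro x hx y hy hxy
    have hy' : y ∈ C.erase x := Finset.mem_erase.mpr ⟨hxy.symm, hy⟩
    have hc : ((C.erase x).erase y).card = 8 := by
      rw [Finset.card_erase_of_mem hy', Finset.card_erase_of_mem hx, hcard]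
    obtain ⟨z, hz'⟩ : ((C.erase x).erase y).Nonempty := by
      rw [← Finset.card_pos, hc]; norm_num
    have e0 := (Finset.sum_eq_zero_iff_of_nonneg (fun x hx => Finset.sum_nonneg fun y hy =>
      Finset.sum_nonneg fun z hz' => (hz x hx y hy z hz').2.1)).mp (le_antisymm (by linarith) n1)
    have e1 := (Finset.sum_eq_zero_iff_of_nonneg (fun y hy =>
      Finset.sum_nonneg fun z hz' => (hz x hx y hy z hz').2.1)).mp (e0 x hx)
    have e2 := (Finset.sum_eq_zero_iff_of_nonneg (fun z hz' =>
      (hz x hx y hy' z hz').2.1)).mp (e1 y hy')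
    have e3 := e2 z hz'
    have hK := hz x hx y hy' z hz'
    simp only [Finset.mem_erase] at hz'
    exact K_zero (hinner x hx y hy hxy) (hinner x hx z hz'.2.2 hz'.2.1.symm)
      (hinner y hy z hz'.2.2 hz'.1.symm) (by linarith)
  · intro x hx
    have e0 := (Finset.sum_eq_zero_iff_of_nonneg (fun x _ => sq_nonneg _)).mp
      (le_antisymm (by linarith) n2)
    exact pow_eq_zero_iff two_ne_zero |>.mp (e0 x hx)

lemma no_triangle {a b c : E4} (ha : ‖a‖ = 1) (hb : ‖b‖ = 1) (hc : ‖c‖ = 1)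
    (h1 : ⟪a, b⟫ = (-2 / 3 : ℝ)) (h2 : ⟪a, c⟫ = (-2 / 3 : ℝ)) (h3 : ⟪b, c⟫ = (-2 / 3 : ℝ)) :
    False := by
  have h : 0 ≤ ⟪a + b + c, a + b + c⟫ := real_inner_self_nonneg
  simp only [inner_add_left, inner_add_right, real_inner_self_eq_norm_sq, ha, hb, hc,
    real_inner_comm a b, real_inner_comm a c, real_inner_comm b c] at h
  simp only [h1, h2, h3] at h
  norm_num at h

open Classical in
/-- Counting in a cubic triangle-free graph on ten vertices; `R` is adjacency and `S` is
non-adjacency of distinct vertices. -/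
lemma counting {V : Type*} (C : Finset V) (hcard : C.card = 10) (R S : V → V → Prop)
    (hRs : ∀ x y, R x y → R y x) (hSs : ∀ x y, S x y → S y x)
    (hR0 : ∀ x ∈ C, ¬ R x x) (hS0 : ∀ x ∈ C, ¬ S x x) (hRS : ∀ x y, R x y → ¬ S x y)
    (htot : ∀ x ∈ C, ∀ y ∈ C, x ≠ y → R x y ∨ S x y)
    (hdeg : ∀ x ∈ C, (C.filter (R x)).card = 3)
    (htri : ∀ x ∈ C, ∀ y ∈ C, ∀ z ∈ C, R x y → R x z → ¬ R y z) :
    ((C ×ˢ C ×ˢ C).filter fun p => R p.1 p.2.1 ∧ R p.1 p.2.2 ∧ S p.2.1 p.2.2).card = 60 ∧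
    ((C ×ˢ C ×ˢ C).filter fun p => R p.1 p.2.1 ∧ S p.1 p.2.2 ∧ S p.2.1 p.2.2).card = 120 ∧
    ((C ×ˢ C ×ˢ C).filter fun p => S p.1 p.2.1 ∧ S p.1 p.2.2 ∧ S p.2.1 p.2.2).card = 180 := by
  have fub : ∀ P Q T : V → V → Prop,
      ((C ×ˢ C ×ˢ C).filter fun p => P p.1 p.2.1 ∧ Q p.1 p.2.2 ∧ T p.2.1 p.2.2).card
      = ∑ x ∈ C, ∑ y ∈ C.filter (P x), (C.filter fun z => Q x z ∧ T y z).card := by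
    intro P Q T
    rw [Finset.card_filter, Finset.sum_product]
    refine Finset.sum_congr rfl fun x _ => ?_
    rw [Finset.sum_product, Finset.sum_filter]
    refine Finset.sum_congr rfl fun y _ => ?_
    by_cases h : P x y
    · simp only [h, true_and, if_true]
      rw [Finset.card_filter]
    · simp [h]
  -- S-neighbourhood has size six
  have hsdeg : ∀ x ∈ C, (C.filter (S x)).card = 6 := by
    intro x hx
    have h : C = insert x (C.filter (R x) ∪ C.filter (S x)) := by
      ext y
      simp only [Finset.mem_insert, Finset.mem_union, Finset.mem_filter]
      constructor
      · intro hy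
        by_cases hxy : x = y
        · exact Or.inl hxy.symm
        · rcases htot x hx y hy hxy with h | h
          · exact Or.inr (Or.inl ⟨hy, h⟩)
          · exact Or.inr (Or.inr ⟨hy, h⟩)
      · rintro (h | h | h)
        · rw [h]; exact hx
        · exact h.1
        · exact h.1
    have hd : Disjoint (C.filter (R x)) (C.filter (S x)) := by
      rw [Finset.disjoint_filter]
      intro y _ h; exact hRS x y h
    have hn : x ∉ C.filter (R x) ∪ C.filter (S x) := by
      simp only [Finset.mem_union, Finset.mem_filter]
      rintro (h | h)
      · exact hR0 x hx h.2
      · exact hS0 x hx h.2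
    have h2 := congrArg Finset.card h
    rw [Finset.card_insert_of_notMem hn, Finset.card_union_of_disjoint hd, hcard, hdeg x hx] at h2
    omega
  -- (R, R, S)
  have c1 : ∀ x ∈ C, ∀ y ∈ C.filter (R x), (C.filter fun z => R x z ∧ S y z).card = 2 := by
    intro x hx y hy
    have hy1 := (Finset.mem_filter.mp hy)
    have : (C.filter fun z => R x z ∧ S y z) = (C.filter (R x)).erase y := by
      ext z
      simp only [Finset.mem_erase, Finset.mem_filter]
      constructor
      · rintro ⟨h1, h2, h3⟩
        refine ⟨?_, h1, h2⟩
        rintro rfl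
        exact hS0 _ h1 h3
      · rintro ⟨h1, h2, h3⟩
        refine ⟨h2, h3, ?_⟩
        rcases htot y hy1.1 z h2 (Ne.symm h1) with h | h
        · exact absurd h (htri x hx y hy1.1 z h2 hy1.2 h3)
        · exact h
    rw [this, Finset.card_erase_of_mem hy, hdeg x hx]
  -- (R, S, R): for y adjacent to x, the neighbours of y other than x
  have c1' : ∀ x ∈ C, ∀ y ∈ C.filter (R x), (C.filter fun z => S x z ∧ R y z).card = 2 := by
    intro x hx y hy
    have hy1 := (Finset.mem_filter.mp hy)
    have := c1 y hy1.1 x (Finset.mem_filter.mpr ⟨hx, hRs _ _ hy1.2⟩)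
    rw [← this]
    congr 1
    ext z
    simp only [Finset.mem_filter]
    tauto
  -- partition of the S-neighbourhood of x according to y
  have part : ∀ x ∈ C, ∀ y ∈ C, (C.filter (S x)).card =
      (if S x y then 1 else 0) + (C.filter fun z => S x z ∧ R y z).card
        + (C.filter fun z => S x z ∧ S y z).card := by
    intro x hx y hy
    have e : (if S x y then 1 else 0) = ∑ z ∈ C, if z = y then (if S x y then 1 else 0) else 0 := by
      simp [hy]
    rw [e, Finset.card_filter, Finset.card_filter, Finset.card_filter, ← Finset.sum_add_distrib,
      ← Finset.sum_add_distrib]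
    refine Finset.sum_congr rfl fun z hz => ?_
    by_cases hzy : z = y
    · subst hzy
      simp [hR0 z hz, hS0 z hz]
    · rcases htot y hy z hz (Ne.symm hzy) with h | h
      · have := hRS y z h
        simp [hzy, h, this]
      · have : ¬ R y z := fun h' => hRS y z h' h
        simp [hzy, h, this]
  have c2 : ∀ x ∈ C, ∀ y ∈ C.filter (R x), (C.filter fun z => S x z ∧ S y z).card = 4 := by
    intro x hx y hy
    have hy1 := (Finset.mem_filter.mp hy)
    have h := part x hx y hy1.1
    rw [hsdeg x hx, c1' x hx y hy, if_neg (hRS x y hy1.2)] at h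
    omega
  -- number of edges inside the S-neighbourhood
  have c3 : ∀ x ∈ C, ∑ y ∈ C.filter (S x), (C.filter fun z => S x z ∧ R y z).card = 12 := by
    intro x hx
    have tot : ∑ y ∈ C, (C.filter fun z => S x z ∧ R y z).card = 18 := by
      simp only [Finset.card_filter]
      rw [Finset.sum_comm]
      have : ∀ z ∈ C, (∑ y ∈ C, if S x z ∧ R y z then 1 else 0) = if S x z then 3 else 0 := by
        intro z hz
        by_cases h : S x z
        · simp only [h, true_and, if_true]
          rw [← Finset.card_filter, ← hdeg z hz]
          congr 1
          ext y
          simp only [Finset.mem_filter]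
          constructor
          · rintro ⟨a, b⟩; exact ⟨a, hRs _ _ b⟩
          · rintro ⟨a, b⟩; exact ⟨a, hRs _ _ b⟩
        · simp [h]
      rw [Finset.sum_congr rfl this, ← Finset.sum_filter, Finset.sum_const, hsdeg x hx]
      rfl
    have sp : ∑ y ∈ C, (C.filter fun z => S x z ∧ R y z).card
        = ∑ y ∈ C.filter (R x), (C.filter fun z => S x z ∧ R y z).card
          + ∑ y ∈ C.filter (S x), (C.filter fun z => S x z ∧ R y z).card := by
      rw [Finset.sum_filter, Finset.sum_filter, ← Finset.sum_add_distrib]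
      refine Finset.sum_congr rfl fun y hy => ?_
      by_cases hxy : x = y
      · subst hxy
        have : (C.filter fun z => S x z ∧ R x z) = ∅ := by
          rw [Finset.filter_eq_empty_iff]
          rintro z _ ⟨h1, h2⟩
          exact hRS _ _ h2 h1
        simp [this]
      · rcases htot x hx y hy hxy with h | h
        · simp [h, hRS x y h]
        · have : ¬ R x y := fun h' => hRS x y h' h
          simp [h, this]
    rw [tot, Finset.sum_congr rfl (c1' x hx), Finset.sum_const, hdeg x hx] at sp
    simp only [smul_eq_mul] at sp
    omega
  have c4 : ∀ x ∈ C, ∑ y ∈ C.filter (S x), (C.filter fun z => S x z ∧ S y z).card = 18 := by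
    intro x hx
    have h : ∑ y ∈ C.filter (S x), (C.filter (S x)).card = ∑ y ∈ C.filter (S x),
        (1 + (C.filter fun z => S x z ∧ R y z).card
        + (C.filter fun z => S x z ∧ S y z).card) := by
      refine Finset.sum_congr rfl fun y hy => ?_
      have hy1 := (Finset.mem_filter.mp hy)
      rw [part x hx y hy1.1, if_pos hy1.2]
    rw [Finset.sum_add_distrib, Finset.sum_add_distrib, c3 x hx, Finset.sum_const,
      Finset.sum_const, hsdeg x hx] at h
    simp only [smul_eq_mul] at h
    omega
  refine ⟨?_, ?_, ?_⟩
  · rw [fub, Finset.sum_congr rfl fun x hx => Finset.sum_congr rfl (c1 x hx),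
      Finset.sum_congr rfl fun x hx => by rw [Finset.sum_const, hdeg x hx], Finset.sum_const, hcard]
    rfl
  · rw [fub, Finset.sum_congr rfl fun x hx => Finset.sum_congr rfl (c2 x hx),
      Finset.sum_congr rfl fun x hx => by rw [Finset.sum_const, hdeg x hx], Finset.sum_const, hcard]
    rfl
  · rw [fub, Finset.sum_congr rfl c4, Finset.sum_const, hcard]
    rfl

lemma degree (C : Finset E4) (hcard : C.card = 10) (hunit : ∀ c ∈ C, ‖c‖ = 1)
    (hval : ∀ x ∈ C, ∀ y ∈ C, x ≠ y → ⟪x, y⟫ = (-2 / 3 : ℝ) ∨ ⟪x, y⟫ = (1 / 6 : ℝ))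
    (hsum : ∀ x ∈ C, ∑ y ∈ C, ⟪x, y⟫ = (0 : ℝ)) (x : E4) (hx : x ∈ C) :
    (C.filter fun y => ⟪x, y⟫ = (-2 / 3 : ℝ)).card = 3 := by
  have hone : ⟪x, x⟫ = (1 : ℝ) := by
    rw [real_inner_self_eq_norm_sq, hunit x hx]; norm_num
  have h : ∀ y ∈ C, ⟪x, y⟫ = (1 / 6 : ℝ) + (if y = x then 5 / 6 else 0)
      - 5 / 6 * (if ⟪x, y⟫ = (-2 / 3 : ℝ) then 1 else 0) := by
    intro y hy
    by_cases hxy : y = x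
    · rw [hxy, hone]; norm_num
    · rcases hval x hx y hy (Ne.symm hxy) with h | h <;> rw [h] <;> norm_num [hxy]
  have h2 := hsum x hx
  rw [Finset.sum_congr rfl h, Finset.sum_sub_distrib, Finset.sum_add_distrib, ← Finset.mul_sum,
    Finset.sum_ite_eq_of_mem' C x _ hx, Finset.sum_const, hcard, ← Finset.natCast_card_filter,
    nsmul_eq_mul] at h2
  push_cast at h2
  have h3 : ((C.filter fun y => ⟪x, y⟫ = (-2 / 3 : ℝ)).card : ℝ) = 3 := by linarith
  exact_mod_cast h3

end PetersenCode

theorem petersen_triple_distance_distribution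
    (C : Finset (EuclideanSpace ℝ (Fin 4)))
    (hcard : C.card = 10)
    (hunit : ∀ c ∈ C, ‖c‖ = 1)
    (hinner : ∀ c ∈ C, ∀ c' ∈ C, c ≠ c' → ⟪c, c'⟫ ≤ (1 / 6 : ℝ)) :
    {p : EuclideanSpace ℝ (Fin 4) × EuclideanSpace ℝ (Fin 4) × EuclideanSpace ℝ (Fin 4) |
      p.1 ∈ C ∧ p.2.1 ∈ C ∧ p.2.2 ∈ C ∧
      (⟪p.1, p.2.1⟫, ⟪p.1, p.2.2⟫, ⟪p.2.1, p.2.2⟫) =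
        ((-2 / 3 : ℝ), (-2 / 3 : ℝ), (1 / 6 : ℝ))}.ncard = 60 ∧
    {p : EuclideanSpace ℝ (Fin 4) × EuclideanSpace ℝ (Fin 4) × EuclideanSpace ℝ (Fin 4) |
      p.1 ∈ C ∧ p.2.1 ∈ C ∧ p.2.2 ∈ C ∧
      (⟪p.1, p.2.1⟫, ⟪p.1, p.2.2⟫, ⟪p.2.1, p.2.2⟫) =
        ((-2 / 3 : ℝ), (1 / 6 : ℝ), (1 / 6 : ℝ))}.ncard = 120 ∧
    {p : EuclideanSpace ℝ (Fin 4) × EuclideanSpace ℝ (Fin 4) × EuclideanSpace ℝ (Fin 4) |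
      p.1 ∈ C ∧ p.2.1 ∈ C ∧ p.2.2 ∈ C ∧
      (⟪p.1, p.2.1⟫, ⟪p.1, p.2.2⟫, ⟪p.2.1, p.2.2⟫) =
        ((1 / 6 : ℝ), (1 / 6 : ℝ), (1 / 6 : ℝ))}.ncard = 180 ∧
    ¬ ∃ c ∈ C, ∃ c' ∈ C, ∃ c'' ∈ C, c ≠ c' ∧ c ≠ c'' ∧ c' ≠ c'' ∧
      ⟪c, c'⟫ = (-2 / 3 : ℝ) ∧ ⟪c, c''⟫ = (-2 / 3 : ℝ) ∧ ⟪c', c''⟫ = (-2 / 3 : ℝ) := by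
  classical
  obtain ⟨hval, hsum⟩ := PetersenCode.consequence C hcard hunit hinner
  have hone : ∀ x ∈ C, ⟪x, x⟫ = (1 : ℝ) := fun x hx => by
    rw [real_inner_self_eq_norm_sq, hunit x hx]; norm_num
  obtain ⟨k1, k2, k3⟩ := PetersenCode.counting C hcard (fun x y => ⟪x, y⟫ = (-2 / 3 : ℝ))
    (fun x y => ⟪x, y⟫ = (1 / 6 : ℝ))
    (fun x y h => by rw [real_inner_comm]; exact h)
    (fun x y h => by rw [real_inner_comm]; exact h)
    (fun x hx h => by rw [hone x hx] at h; norm_num at h)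
    (fun x hx h => by rw [hone x hx] at h; norm_num at h)
    (fun x y h h' => by rw [h] at h'; norm_num at h')
    hval
    (fun x hx => by
      rw [← PetersenCode.degree C hcard hunit hval hsum x hx])
    (fun x hx y hy z hz h1 h2 h3 =>
      PetersenCode.no_triangle (hunit x hx) (hunit y hy) (hunit z hz) h1 h2 h3)
  refine ⟨?_, ?_, ?_, ?_⟩
  · rw [← k1, ← Set.ncard_coe_finset]
    congr 1
    ext p
    simp [and_assoc]
  · rw [← k2, ← Set.ncard_coe_finset]
    congr 1
    ext p
    simp [and_assoc]
  · rw [← k3, ← Set.ncard_coe_finset]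
    congr 1
    ext p
    simp [and_assoc]
  · rintro ⟨a, ha, b, hb, c, hc, -, -, -, h1, h2, h3⟩
    exact PetersenCode.no_triangle (hunit a ha) (hunit b hb) (hunit c hc) h1 h2 h3
end

section
/- Let C be a 10-element subset of the unit sphere S³ ⊆ ℝ⁴ such that any two distinct points of C have inner product at most 1/6. Define a graph on C by joining c and c' whenever ⟨c, c'⟩ = −2/3. Then this graph is strongly regular with parameters (ν, k, λ, μ) = (10, 3, 0, 1): every point c ∈ C has exactly 3 points c' ∈ C with ⟨c, c'⟩ = −2/3; for every pair c, c' with ⟨c, c'⟩ = −2/3 there is no c'' ∈ C with ⟨c, c''⟩ = ⟨c', c''⟩ = −2/3; and for every pair of distinct c, c' with ⟨c, c'⟩ = 1/6 there is exactly one c'' ∈ C with ⟨c, c''⟩ = ⟨c', c''⟩ = −2/3. (Hence the −2/3-graph of C is the Petersen graph.) -/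
open scoped RealInnerProductSpace

set_option linter.unusedVariables false

noncomputable section

/-- Polynomial 0 of the zonal block of degree 0. -/
def pet_p0 (u : ℝ) : ℝ := -1182/24275 + 23231/24275 * u + 5184/24275 * u ^ 2 - 8208/24275 * u ^ 3

/-- Polynomial 1 of the zonal block of degree 0. -/
def pet_p1 (u : ℝ) : ℝ := 5323649/10234260 + 555609/2274280 * u - 2803967/1137140 * u ^ 2 + 3941107/568570 * u ^ 3

/-- Polynomial 2 of the zonal block of degree 0. -/
def pet_p2 (u : ℝ) : ℝ := 1/9 + 1/12 * u - 1/2 * u ^ 2 + u ^ 3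

/-- The positive definite three-point kernel. -/
def pet_F (u v t : ℝ) : ℝ :=
  24275/108 * (pet_p0 u * pet_p0 v) +
  56857/971 * (pet_p1 u * pet_p1 v) +
  1136519137/5685700 * (pet_p2 u * pet_p2 v) +
  3951 * ((u - 1/6) ^ 2 * (v - 1/6) ^ 2 * (t - u * v)) +
  10975/24 * ((t - u * v) ^ 2 - (1 - u ^ 2) * (1 - v ^ 2) / 3)

def pet_bS0 (u v t : ℝ) : ℝ := -2/9 + 1/2 * t + 1/2 * v + t ^ 2 + v ^ 2

def pet_bS1 (u v t : ℝ) : ℝ := 1/27 - 1/9 * t - 1/9 * v - 1/6 * u + 1/2 * u * t + 1/2 * u * v - 1/3 * u ^ 2 + u ^ 2 * t + u ^ 2 * v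

def pet_bS2 (u v t : ℝ) : ℝ := 1/27 - 1/12 * t - 1/12 * v - 2/9 * u - 1/6 * t ^ 2 - 1/6 * v ^ 2 + 1/2 * u * t + 1/2 * u * v + u * t ^ 2 + u * v ^ 2

def pet_bS3 (u v t : ℝ) : ℝ := 2/9 - 11/18 * t - 11/18 * v - 1/2 * t ^ 2 - 1/2 * v ^ 2 + t ^ 3 + v ^ 3

def pet_bS4 (u v t : ℝ) : ℝ := 1/27 - 7/36 * t - 7/36 * v - 1/6 * t ^ 2 + v * t - 1/6 * v ^ 2 + v * t ^ 2 + v ^ 2 * t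

def pet_sS (u v t : ℝ) : ℝ :=
  11101/72 * (pet_bS0 u v t + 144/11101 * pet_bS1 u v t + 144/11101 * pet_bS2 u v t + 6552/11101 * pet_bS3 u v t - 60936/55505 * pet_bS4 u v t) ^ 2 +
  44116/11101 * (pet_bS1 u v t + 10813/44116 * pet_bS2 u v t - 2003/44116 * pet_bS3 u v t + 66367/220580 * pet_bS4 u v t) ^ 2 +
  76555/44116 * (pet_bS2 u v t - 6009/76555 * pet_bS3 u v t - 21479/382775 * pet_bS4 u v t) ^ 2 +
  250439/76555 * (pet_bS3 u v t - 2754869/5008780 * pet_bS4 u v t) ^ 2 +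
  166617209/20035120 * (pet_bS4 u v t) ^ 2

def pet_bA0 (u v t : ℝ) : ℝ := -4/3 - 2/3 * u + 2 * u ^ 2

def pet_bA1 (u v t : ℝ) : ℝ := -2/9 + 2/3 * t + 2/3 * v - 1/3 * u + u * t + u * v

def pet_bA2 (u v t : ℝ) : ℝ := -2/9 + 1/2 * t + 1/2 * v + t ^ 2 + v ^ 2

def pet_bA3 (u v t : ℝ) : ℝ := 1/18 - 1/3 * t - 1/3 * v + 2 * v * t

def pet_bA4 (u v t : ℝ) : ℝ := 4/3 + 2 * u

def pet_sA (u v t : ℝ) : ℝ :=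
  75 * (pet_bA0 u v t - 119/75 * pet_bA1 u v t + 7/15 * pet_bA2 u v t - 3641/1800 * pet_bA3 u v t + 8/5 * pet_bA4 u v t) ^ 2 +
  14101/50 * (pet_bA1 u v t + 680/42303 * pet_bA2 u v t - 57527/253818 * pet_bA3 u v t + 493055/2030544 * pet_bA4 u v t) ^ 2 +
  5278627/126909 * (pet_bA2 u v t + 7861525/3089928 * pet_bA3 u v t - 36703271/63343524 * pet_bA4 u v t) ^ 2 +
  2517566737/37079136 * (pet_bA3 u v t - 2372339063/5035133474 * pet_bA4 u v t) ^ 2 +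
  6043898007541157/1426916545463808 * (pet_bA4 u v t) ^ 2

def pet_bB0 (u v t : ℝ) : ℝ := 4/3 + v + u

def pet_bB1 (u v t : ℝ) : ℝ := -4/3 - 1/3 * v - 1/3 * u + v ^ 2 + u ^ 2

def pet_sB (u v t : ℝ) : ℝ :=
  83 * (pet_bB0 u v t + 7571/4980 * pet_bB1 u v t) ^ 2 +
  2888159/298800 * (pet_bB1 u v t) ^ 2

def pet_M (u v t : ℝ) : ℝ :=
  pet_sS u v t + (1/6 - u) * pet_sA u v t + (1/6 - u) * (1/6 - v) * pet_sB u v t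

/-- Contribution of coincident pairs. -/
def pet_G (w : ℝ) : ℝ := pet_F 1 w w + pet_F w 1 w + pet_F w w 1

/-- The cyclically symmetrized polynomial attached to a triple of distinct points. -/
def pet_H (u v t : ℝ) : ℝ :=
  pet_F u v t + pet_F t u v + pet_F v t u + (pet_G u + pet_G v + pet_G t) / 8 +
    pet_F 1 1 1 / 24

theorem pet_identity (u v t : ℝ) :
    2 * pet_H u v t + (pet_M u v t + pet_M u t v + pet_M v u t + pet_M v t u + pet_M t u v +
      pet_M t v u) = 0 := by
  simp only [pet_H, pet_G, pet_F, pet_p0, pet_p1, pet_p2, pet_M, pet_sS, pet_sA, pet_sB,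
    pet_bS0, pet_bS1, pet_bS2, pet_bS3, pet_bS4, pet_bA0, pet_bA1, pet_bA2, pet_bA3, pet_bA4,
    pet_bB0, pet_bB1]
  ring

theorem pet_M_lower (u v t : ℝ) (hu : u ≤ 1/6) (hv : v ≤ 1/6) :
    (1/6 - u) * (u + 2/3) ^ 2 ≤ pet_M u v t := by
  have hS : 0 ≤ pet_sS u v t := by unfold pet_sS; positivity
  have hB : 0 ≤ pet_sB u v t := by unfold pet_sB; positivity
  have hA : (u + 2/3) ^ 2 ≤ pet_sA u v t := by
    have h1 : 0 ≤ pet_sA u v t - 6043898007541157/1426916545463808 * (pet_bA4 u v t) ^ 2 := by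
      unfold pet_sA
      rw [add_sub_cancel_right]
      positivity
    have h2 : (pet_bA4 u v t) ^ 2 = 4 * (u + 2/3) ^ 2 := by unfold pet_bA4; ring
    rw [h2] at h1
    nlinarith [sq_nonneg (u + 2/3)]
  have hu' : 0 ≤ 1/6 - u := by linarith
  have hv' : 0 ≤ 1/6 - v := by linarith
  have := mul_le_mul_of_nonneg_left hA hu'
  have := mul_nonneg (mul_nonneg hu' hv') hB
  unfold pet_M
  linarith

theorem pet_M_nonneg (u v t : ℝ) (hu : u ≤ 1/6) (hv : v ≤ 1/6) : 0 ≤ pet_M u v t :=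
  le_trans (mul_nonneg (by linarith) (sq_nonneg _)) (pet_M_lower u v t hu hv)

theorem pet_H_le (u v t : ℝ) (hu : u ≤ 1/6) (hv : v ≤ 1/6) (ht : t ≤ 1/6) :
    2 * pet_H u v t ≤ - ((1/6 - u) * (u + 2/3) ^ 2) := by
  have := pet_identity u v t
  have := pet_M_lower u v t hu hv
  have := pet_M_nonneg u t v hu ht
  have := pet_M_nonneg v u t hv hu
  have := pet_M_nonneg v t u hv ht
  have := pet_M_nonneg t u v ht hu
  have := pet_M_nonneg t v u ht hv
  linarith

theorem pet_H_nonpos (u v t : ℝ) (hu : u ≤ 1/6) (hv : v ≤ 1/6) (ht : t ≤ 1/6) :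
    pet_H u v t ≤ 0 := by
  have := pet_H_le u v t hu hv ht
  have : 0 ≤ (1/6 - u) * (u + 2/3) ^ 2 := mul_nonneg (by linarith) (sq_nonneg _)
  linarith

theorem pet_H_zero (u v t : ℝ) (hu : u ≤ 1/6) (hv : v ≤ 1/6) (ht : t ≤ 1/6)
    (h : pet_H u v t = 0) : u = -2/3 ∨ u = 1/6 := by
  have h1 := pet_H_le u v t hu hv ht
  have h2 : 0 ≤ (1/6 - u) * (u + 2/3) ^ 2 := mul_nonneg (by linarith) (sq_nonneg _)
  have h3 : (1/6 - u) * (u + 2/3) ^ 2 = 0 := by linarith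
  rcases mul_eq_zero.1 h3 with h4 | h4
  · right; linarith
  · left
    have := pow_eq_zero_iff (two_ne_zero) |>.1 h4
    linarith

end

/-! ### Positivity of the three-point kernel -/

abbrev E4 := EuclideanSpace ℝ (Fin 4)

theorem pet_inner_eq (x y : E4) : ⟪x, y⟫ = ∑ i, x i * y i := by
  simp [PiLp.inner_apply, mul_comm]

theorem pet_psd0 (C : Finset E4) (c : E4) (p : ℝ → ℝ) :
    0 ≤ ∑ x ∈ C, ∑ y ∈ C, p ⟪c, x⟫ * p ⟪c, y⟫ := by
  rw [← Finset.sum_mul_sum]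
  exact mul_self_nonneg _

theorem pet_psd1 (C : Finset E4) (c : E4) (hc : ‖c‖ = 1) (r : ℝ → ℝ) :
    0 ≤ ∑ x ∈ C, ∑ y ∈ C, r ⟪c, x⟫ * r ⟪c, y⟫ * (⟪x, y⟫ - ⟪c, x⟫ * ⟪c, y⟫) := by
  have h := real_inner_self_nonneg (x := ∑ x ∈ C, r ⟪c, x⟫ • (x - ⟪c, x⟫ • c))
  rw [sum_inner] at h
  refine le_of_le_of_eq h (Finset.sum_congr rfl fun x _ => ?_)
  rw [inner_sum]
  refine Finset.sum_congr rfl fun y _ => ?_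
  have hcc : ⟪c, c⟫ = (1 : ℝ) := by rw [real_inner_self_eq_norm_sq, hc]; norm_num
  simp only [inner_smul_left, inner_smul_right, inner_sub_left, inner_sub_right, hcc,
    real_inner_comm c x]
  simp
  ring

/-- The algebraic identity behind the degree 2 kernel. -/
theorem pet_tensor_identity (c x y : Fin 4 → ℝ) (α β : ℝ) :
    ∑ i, ∑ j, (x i * x j - α * ((if i = j then 1 else 0) - c i * c j)) *
        (y i * y j - β * ((if i = j then 1 else 0) - c i * c j)) =
      (∑ i, x i * y i) ^ 2 - β * ((∑ i, x i * x i) - (∑ i, c i * x i) ^ 2)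
        - α * ((∑ i, y i * y i) - (∑ i, c i * y i) ^ 2)
        + α * β * (4 - 2 * (∑ i, c i * c i) + (∑ i, c i * c i) ^ 2) := by
  simp [Fin.sum_univ_four]
  ring

theorem pet_psd2 (C : Finset E4) (hunit : ∀ c ∈ C, ‖c‖ = 1) (c : E4) (hc : ‖c‖ = 1) :
    0 ≤ ∑ x ∈ C, ∑ y ∈ C,
      ((⟪x, y⟫ - ⟪c, x⟫ * ⟪c, y⟫) ^ 2 - (1 - ⟪c, x⟫ ^ 2) * (1 - ⟪c, y⟫ ^ 2) / 3 : ℝ) := by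
  have hcc : ⟪c, c⟫ = (1 : ℝ) := by rw [real_inner_self_eq_norm_sq, hc]; norm_num
  let T : E4 → Fin 4 → Fin 4 → ℝ := fun x i j =>
    (x - ⟪c, x⟫ • c) i * (x - ⟪c, x⟫ • c) j -
      (1 - ⟪c, x⟫ ^ 2) / 3 * ((if i = j then 1 else 0) - c i * c j)
  have h : 0 ≤ ∑ i, ∑ j, (∑ x ∈ C, T x i j) * (∑ y ∈ C, T y i j) :=
    Finset.sum_nonneg fun i _ => Finset.sum_nonneg fun j _ => mul_self_nonneg _
  have h2 : ∑ i, ∑ j, (∑ x ∈ C, T x i j) * (∑ y ∈ C, T y i j) =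
      ∑ x ∈ C, ∑ y ∈ C, ∑ i, ∑ j, T x i j * T y i j := by
    simp only [Finset.sum_mul_sum]
    calc _ = ∑ i, ∑ x ∈ C, ∑ j, ∑ y ∈ C, T x i j * T y i j :=
          Finset.sum_congr rfl fun i _ => Finset.sum_comm
      _ = ∑ x ∈ C, ∑ i, ∑ j, ∑ y ∈ C, T x i j * T y i j := Finset.sum_comm
      _ = ∑ x ∈ C, ∑ i, ∑ y ∈ C, ∑ j, T x i j * T y i j :=
          Finset.sum_congr rfl fun x _ => Finset.sum_congr rfl fun i _ => Finset.sum_comm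
      _ = _ := Finset.sum_congr rfl fun x _ => Finset.sum_comm
  rw [h2] at h
  refine le_of_le_of_eq h (Finset.sum_congr rfl fun x hx => Finset.sum_congr rfl fun y hy => ?_)
  have hxx : ⟪x, x⟫ = (1 : ℝ) := by rw [real_inner_self_eq_norm_sq, hunit x hx]; norm_num
  have hyy : ⟪y, y⟫ = (1 : ℝ) := by rw [real_inner_self_eq_norm_sq, hunit y hy]; norm_num
  have key := pet_tensor_identity c (x - ⟪c, x⟫ • c : E4) (y - ⟪c, y⟫ • c : E4)
    ((1 - ⟪c, x⟫ ^ 2) / 3) ((1 - ⟪c, y⟫ ^ 2) / 3)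
  simp only [← pet_inner_eq] at key
  refine key.trans ?_
  simp only [inner_smul_left, inner_smul_right, inner_sub_left, inner_sub_right, hcc, hxx, hyy,
    real_inner_comm c x, real_inner_comm c y]
  simp
  ring

theorem pet_psd (C : Finset E4) (hunit : ∀ c ∈ C, ‖c‖ = 1) (c : E4) (hc : ‖c‖ = 1) :
    0 ≤ ∑ x ∈ C, ∑ y ∈ C, pet_F ⟪c, x⟫ ⟪c, y⟫ ⟪x, y⟫ := by
  have h0 := pet_psd0 C c pet_p0
  have h1 := pet_psd0 C c pet_p1
  have h2 := pet_psd0 C c pet_p2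
  have h3 := pet_psd1 C c hc (fun u => (u - 1/6) ^ 2)
  have h4 := pet_psd2 C hunit c hc
  have n0 := mul_nonneg (by norm_num : (0 : ℝ) ≤ 24275/108) h0
  have n1 := mul_nonneg (by norm_num : (0 : ℝ) ≤ 56857/971) h1
  have n2 := mul_nonneg (by norm_num : (0 : ℝ) ≤ 1136519137/5685700) h2
  have n3 := mul_nonneg (by norm_num : (0 : ℝ) ≤ 3951) h3
  have n4 := mul_nonneg (by norm_num : (0 : ℝ) ≤ 10975/24) h4
  simp only [Finset.mul_sum] at n0 n1 n2 n3 n4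
  simp only [pet_F, Finset.sum_add_distrib]
  exact add_nonneg (add_nonneg (add_nonneg (add_nonneg n0 n1) n2) n3) n4

/-! ### Passing to distinct triples -/

open Classical in
/-- Sum over pairs, reduced to pairs of points which are distinct from each other and from `c`. -/
theorem pet_split (C : Finset E4) (hcard : C.card = 10) (c : E4) (hc : c ∈ C)
    (f : E4 → E4 → ℝ) :
    ∑ x ∈ C, ∑ y ∈ C, f x y = ∑ x ∈ C, ∑ y ∈ C, (if x ≠ c ∧ y ≠ c ∧ x ≠ y then
      f x y + (f c x + f x c + f x x) / 8 + f c c / 72 else 0) := by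
  have hcard' : (C.erase c).card = 9 := by rw [Finset.card_erase_of_mem hc, hcard]
  have hR : ∀ g : E4 → E4 → ℝ,
      ∑ x ∈ C, ∑ y ∈ C, (if x ≠ c ∧ y ≠ c ∧ x ≠ y then g x y else 0) =
      ∑ x ∈ C.erase c, ∑ y ∈ (C.erase c).erase x, g x y := by
    intro g
    rw [← Finset.add_sum_erase C _ hc]
    simp only [ne_eq, not_true_eq_false, false_and, if_false, Finset.sum_const_zero, zero_add]
    refine Finset.sum_congr rfl fun x hx => ?_
    rw [← Finset.sum_filter]
    refine Finset.sum_congr ?_ fun _ _ => rfl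
    ext y
    simp only [Finset.mem_filter, Finset.mem_erase] at hx ⊢
    grind
  rw [hR]
  have h1 : ∀ x ∈ C.erase c, ∑ y ∈ (C.erase c).erase x,
      (f x y + (f c x + f x c + f x x) / 8 + f c c / 72) =
      (∑ y ∈ C.erase c, f x y) + f c x + f x c + f c c / 9 := by
    intro x hx
    have hc8 : ((C.erase c).erase x).card = 8 := by rw [Finset.card_erase_of_mem hx, hcard']
    rw [Finset.sum_add_distrib, Finset.sum_add_distrib, Finset.sum_const, Finset.sum_const, hc8,
      ← Finset.add_sum_erase (C.erase c) _ hx]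
    simp only [nsmul_eq_mul]
    push_cast
    ring
  rw [Finset.sum_congr rfl h1, ← Finset.add_sum_erase C _ hc, ← Finset.add_sum_erase C _ hc]
  have h2 : ∀ x ∈ C.erase c, ∑ y ∈ C, f x y = f x c + ∑ y ∈ C.erase c, f x y := by
    intro x _
    rw [← Finset.add_sum_erase C _ hc]
  rw [Finset.sum_congr rfl h2]
  simp only [Finset.sum_add_distrib, Finset.sum_const, hcard', nsmul_eq_mul]
  push_cast
  ring

open Classical in
/-- The local summand on distinct triples. -/
noncomputable def pet_J (c x y : E4) : ℝ :=
  if x ≠ c ∧ y ≠ c ∧ x ≠ y then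
    pet_F ⟪c, x⟫ ⟪c, y⟫ ⟪x, y⟫ + pet_G ⟪c, x⟫ / 8 + pet_F 1 1 1 / 72 else 0

theorem pet_total (C : Finset E4) (hcard : C.card = 10) (hunit : ∀ c ∈ C, ‖c‖ = 1) :
    0 ≤ ∑ c ∈ C, ∑ x ∈ C, ∑ y ∈ C, pet_J c x y := by
  refine Finset.sum_nonneg fun c hc => ?_
  have h := pet_psd C hunit c (hunit c hc)
  rw [pet_split C hcard c hc] at h
  refine le_of_le_of_eq h (Finset.sum_congr rfl fun x hx => Finset.sum_congr rfl fun y hy => ?_)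
  have hself : ∀ z ∈ C, ⟪z, z⟫ = (1 : ℝ) := fun z hz => by
    rw [real_inner_self_eq_norm_sq, hunit z hz]; norm_num
  unfold pet_J pet_G
  rw [hself c hc, hself x hx, real_inner_comm c x]

theorem pet_two_values (C : Finset E4) (hcard : C.card = 10) (hunit : ∀ c ∈ C, ‖c‖ = 1)
    (hinner : ∀ c ∈ C, ∀ c' ∈ C, c ≠ c' → ⟪c, c'⟫ ≤ (1 / 6 : ℝ)) :
    ∀ c ∈ C, ∀ x ∈ C, c ≠ x → ⟪c, x⟫ = (-2/3 : ℝ) ∨ ⟪c, x⟫ = (1/6 : ℝ) := by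
  classical
  have h1 := pet_total C hcard hunit
  have e2 : ∑ c ∈ C, ∑ x ∈ C, ∑ y ∈ C, pet_J x y c = ∑ c ∈ C, ∑ x ∈ C, ∑ y ∈ C, pet_J c x y := by
    rw [Finset.sum_comm]
    exact Finset.sum_congr rfl fun x _ => Finset.sum_comm
  have e3 : ∑ c ∈ C, ∑ x ∈ C, ∑ y ∈ C, pet_J y c x = ∑ c ∈ C, ∑ x ∈ C, ∑ y ∈ C, pet_J c x y := by
    calc _ = ∑ c ∈ C, ∑ y ∈ C, ∑ x ∈ C, pet_J y c x :=
          Finset.sum_congr rfl fun c _ => Finset.sum_comm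
      _ = _ := Finset.sum_comm
  have h4 : 0 ≤ ∑ c ∈ C, ∑ x ∈ C, ∑ y ∈ C, (pet_J c x y + pet_J x y c + pet_J y c x) := by
    simp only [Finset.sum_add_distrib]
    linarith
  have hJ : ∀ c x y : E4, x ≠ c → y ≠ c → x ≠ y →
      pet_J c x y + pet_J x y c + pet_J y c x = pet_H ⟪c, x⟫ ⟪c, y⟫ ⟪x, y⟫ := by
    intro c x y hxc hyc hxy
    unfold pet_J pet_H
    rw [if_pos ⟨hxc, hyc, hxy⟩, if_pos ⟨hxy.symm, hxc.symm, hyc⟩, if_pos ⟨hyc.symm, hxy, hxc.symm⟩,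
      real_inner_comm c x, real_inner_comm c y, real_inner_comm x y]
    ring
  have hle : ∀ c ∈ C, ∀ x ∈ C, ∀ y ∈ C, pet_J c x y + pet_J x y c + pet_J y c x ≤ 0 := by
    intro c hc x hx y hy
    by_cases h : x ≠ c ∧ y ≠ c ∧ x ≠ y
    · rw [hJ c x y h.1 h.2.1 h.2.2]
      exact pet_H_nonpos _ _ _ (hinner c hc x hx h.1.symm) (hinner c hc y hy h.2.1.symm)
        (hinner x hx y hy h.2.2)
    · unfold pet_J
      rw [if_neg h, if_neg (by grind), if_neg (by grind)]
      simp
  have hzero : ∀ c ∈ C, ∀ x ∈ C, ∀ y ∈ C, pet_J c x y + pet_J x y c + pet_J y c x = 0 := by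
    have hxle : ∀ c ∈ C, ∀ x ∈ C, ∑ y ∈ C, (pet_J c x y + pet_J x y c + pet_J y c x) ≤ 0 :=
      fun c hc x hx => Finset.sum_nonpos (hle c hc x hx)
    have hcle : ∀ c ∈ C, ∑ x ∈ C, ∑ y ∈ C, (pet_J c x y + pet_J x y c + pet_J y c x) ≤ 0 :=
      fun c hc => Finset.sum_nonpos (hxle c hc)
    have a1 := (Finset.sum_eq_zero_iff_of_nonpos hcle).1
      (le_antisymm (Finset.sum_nonpos hcle) h4)
    intro c hc x hx y hy
    have a2 := (Finset.sum_eq_zero_iff_of_nonpos (hxle c hc)).1 (a1 c hc)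
    exact (Finset.sum_eq_zero_iff_of_nonpos (hle c hc x hx)).1 (a2 x hx) y hy
  intro c hc x hx hcx
  obtain ⟨y, hy⟩ : ((C.erase c).erase x).Nonempty := by
    rw [← Finset.card_pos, Finset.card_erase_of_mem (Finset.mem_erase.2 ⟨hcx.symm, hx⟩),
      Finset.card_erase_of_mem hc, hcard]
    norm_num
  simp only [Finset.mem_erase] at hy
  have := hzero c hc x hx y hy.2.2
  rw [hJ c x y hcx.symm hy.2.1 (Ne.symm hy.1)] at this
  exact pet_H_zero _ _ _ (hinner c hc x hx hcx) (hinner c hc y hy.2.2 (Ne.symm hy.2.1))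
    (hinner x hx y hy.2.2 (Ne.symm hy.1)) this

/-! ### Combinatorial consequences -/

open Classical in
/-- Indicator of the `-2/3`-graph. -/
noncomputable def pet_adj (c x : E4) : ℝ := if ⟪c, x⟫ = (-2/3 : ℝ) then 1 else 0

set_option maxHeartbeats 1000000 in
theorem petersen_graph_strongly_regular
    (C : Finset (EuclideanSpace ℝ (Fin 4)))
    (hcard : C.card = 10)
    (hunit : ∀ c ∈ C, ‖c‖ = 1)
    (hinner : ∀ c ∈ C, ∀ c' ∈ C, c ≠ c' → ⟪c, c'⟫ ≤ (1 / 6 : ℝ)) :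
    (∀ c ∈ C, {c' : EuclideanSpace ℝ (Fin 4) |
        c' ∈ C ∧ ⟪c, c'⟫ = (-2 / 3 : ℝ)}.ncard = 3) ∧
    (∀ c ∈ C, ∀ c' ∈ C, ⟪c, c'⟫ = (-2 / 3 : ℝ) →
      ¬ ∃ c'' ∈ C, ⟪c, c''⟫ = (-2 / 3 : ℝ) ∧ ⟪c', c''⟫ = (-2 / 3 : ℝ)) ∧
    (∀ c ∈ C, ∀ c' ∈ C, c ≠ c' → ⟪c, c'⟫ = (1 / 6 : ℝ) →
      ∃! c'' : EuclideanSpace ℝ (Fin 4),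
        c'' ∈ C ∧ ⟪c, c''⟫ = (-2 / 3 : ℝ) ∧ ⟪c', c''⟫ = (-2 / 3 : ℝ)) := by
  classical
  have htwo := pet_two_values C hcard hunit hinner
  have hself : ∀ z ∈ C, ⟪z, z⟫ = (1 : ℝ) := fun z hz => by
    rw [real_inner_self_eq_norm_sq, hunit z hz]; norm_num
  have hip : ∀ c ∈ C, ∀ x ∈ C,
      ⟪c, x⟫ = (1/6 - 5/6 * pet_adj c x + 5/6 * (if c = x then 1 else 0) : ℝ) := by
    intro c hc x hx
    unfold pet_adj
    by_cases h : c = x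
    · subst h
      rw [hself c hc]; norm_num
    · rcases htwo c hc x hx h with h' | h' <;> rw [h'] <;> norm_num [h]
  have hadj_self : ∀ c ∈ C, pet_adj c c = 0 := by
    intro c hc
    unfold pet_adj
    rw [hself c hc]; norm_num
  have hadj_sq : ∀ c x, pet_adj c x * pet_adj c x = pet_adj c x := by
    intro c x; unfold pet_adj; split_ifs <;> norm_num
  -- row sums
  have hrow : ∀ c ∈ C, ∑ x ∈ C, ⟪c, x⟫ = 5/2 - 5/6 * ∑ x ∈ C, pet_adj c x := by
    intro c hc
    rw [Finset.sum_congr rfl (hip c hc), Finset.sum_add_distrib, Finset.sum_sub_distrib,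
      ← Finset.mul_sum, ← Finset.mul_sum, Finset.sum_ite_eq, if_pos hc, Finset.sum_const, hcard]
    norm_num
    ring
  have hrow2 : ∀ c ∈ C, ∑ x ∈ C, ⟪c, x⟫ ^ 2 = 5/4 + 5/12 * ∑ x ∈ C, pet_adj c x := by
    intro c hc
    have h : ∀ x ∈ C, ⟪c, x⟫ ^ 2 =
        (1/36 + 5/12 * pet_adj c x + 35/36 * (if c = x then 1 else 0) : ℝ) := by
      intro x hx
      rw [hip c hc x hx]
      by_cases h : c = x
      · subst h; rw [hadj_self c hc]; norm_num
      · simp only [h, if_false]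
        linear_combination 25/36 * hadj_sq c x
    rw [Finset.sum_congr rfl h, Finset.sum_add_distrib, Finset.sum_add_distrib,
      ← Finset.mul_sum, ← Finset.mul_sum, Finset.sum_ite_eq, if_pos hc, Finset.sum_const, hcard]
    norm_num
    ring
  -- the total number of ordered edges is 30
  have hnorm : ⟪∑ x ∈ C, x, ∑ x ∈ C, x⟫ = 25 - 5/6 * ∑ c ∈ C, ∑ x ∈ C, pet_adj c x := by
    rw [sum_inner]
    have : ∀ c ∈ C, ⟪c, ∑ x ∈ C, x⟫ = 5/2 - 5/6 * ∑ x ∈ C, pet_adj c x := by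
      intro c hc; rw [inner_sum]; exact hrow c hc
    rw [Finset.sum_congr rfl this, Finset.sum_sub_distrib, ← Finset.mul_sum, Finset.sum_const,
      hcard]
    norm_num
  have hframe : ∑ i : Fin 4, ∑ j : Fin 4,
      ((∑ x ∈ C, x i * x j) - 5/2 * (if i = j then 1 else 0)) ^ 2 =
      (∑ c ∈ C, ∑ x ∈ C, ⟪c, x⟫ ^ 2) - 25 := by
    have e1 : ∑ c ∈ C, ∑ x ∈ C, ⟪c, x⟫ ^ 2 =
        ∑ i : Fin 4, ∑ j : Fin 4, (∑ x ∈ C, x i * x j) ^ 2 := by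
      have : ∀ c x : E4, ⟪c, x⟫ ^ 2 = ∑ i, ∑ j, (c i * c j) * (x i * x j) := by
        intro c x
        rw [pet_inner_eq, sq, Finset.sum_mul_sum]
        exact Finset.sum_congr rfl fun i _ => Finset.sum_congr rfl fun j _ => by ring
      simp only [this, sq, Finset.sum_mul_sum]
      symm
      calc _ = ∑ i, ∑ x ∈ C, ∑ j, ∑ y ∈ C, x i * x j * (y i * y j) :=
            Finset.sum_congr rfl fun i _ => Finset.sum_comm
        _ = ∑ x ∈ C, ∑ i, ∑ j, ∑ y ∈ C, x i * x j * (y i * y j) := Finset.sum_comm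
        _ = ∑ x ∈ C, ∑ i, ∑ y ∈ C, ∑ j, x i * x j * (y i * y j) :=
            Finset.sum_congr rfl fun x _ => Finset.sum_congr rfl fun i _ => Finset.sum_comm
        _ = _ := Finset.sum_congr rfl fun x _ => Finset.sum_comm
    have e2 : ∑ i : Fin 4, ∑ x ∈ C, x i * x i = 10 := by
      rw [Finset.sum_comm]
      simp only [← pet_inner_eq]
      rw [Finset.sum_congr rfl hself]
      simp [hcard]
    rw [e1]
    simp only [Fin.sum_univ_four] at e2 ⊢
    simp
    linear_combination (-5) * e2
  have hD : ∑ c ∈ C, ∑ x ∈ C, ⟪c, x⟫ ^ 2 = 25/2 + 5/12 * ∑ c ∈ C, ∑ x ∈ C, pet_adj c x := by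
    rw [Finset.sum_congr rfl hrow2, Finset.sum_add_distrib, ← Finset.mul_sum, Finset.sum_const,
      hcard]
    norm_num
  have hfr_nn : 0 ≤ ∑ i : Fin 4, ∑ j : Fin 4,
      ((∑ x ∈ C, x i * x j) - 5/2 * (if i = j then 1 else 0)) ^ 2 :=
    Finset.sum_nonneg fun i _ => Finset.sum_nonneg fun j _ => sq_nonneg _
  have hnn : (0 : ℝ) ≤ ⟪∑ x ∈ C, x, ∑ x ∈ C, x⟫ := real_inner_self_nonneg
  have hS : ∑ c ∈ C, ∑ x ∈ C, pet_adj c x = 30 := by linarith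
  have hsum0 : ∑ x ∈ C, x = 0 := by
    rw [← inner_self_eq_zero (𝕜 := ℝ), hnorm, hS]; norm_num
  have hdeg : ∀ c ∈ C, ∑ x ∈ C, pet_adj c x = 3 := by
    intro c hc
    have := hrow c hc
    rw [← inner_sum, hsum0, inner_zero_right] at this
    linarith
  have hfr0 : ∀ i j : Fin 4, ∑ x ∈ C, x i * x j = 5/2 * (if i = j then 1 else 0) := by
    have h0 : ∑ i : Fin 4, ∑ j : Fin 4,
      ((∑ x ∈ C, x i * x j) - 5/2 * (if i = j then 1 else 0)) ^ 2 = 0 := by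
      rw [hframe, hD, hS]; norm_num
    intro i j
    have a1 := (Finset.sum_eq_zero_iff_of_nonneg
      (fun i _ => Finset.sum_nonneg fun j _ => sq_nonneg _)).1 h0 i (Finset.mem_univ _)
    have a2 := (Finset.sum_eq_zero_iff_of_nonneg (fun j _ => sq_nonneg _)).1 a1 j
      (Finset.mem_univ _)
    have := pow_eq_zero_iff (two_ne_zero) |>.1 a2
    linarith
  have htight : ∀ c c' : E4, ∑ x ∈ C, ⟪c, x⟫ * ⟪c', x⟫ = 5/2 * ⟪c, c'⟫ := by
    intro c c'
    have e1 : ∑ x ∈ C, ⟪c, x⟫ * ⟪c', x⟫ = ∑ i, ∑ j, c i * c' j * ∑ x ∈ C, x i * x j := by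
      have : ∀ x : E4, ⟪c, x⟫ * ⟪c', x⟫ = ∑ i, ∑ j, c i * c' j * (x i * x j) := by
        intro x
        rw [pet_inner_eq, pet_inner_eq, Finset.sum_mul_sum]
        exact Finset.sum_congr rfl fun i _ => Finset.sum_congr rfl fun j _ => by ring
      simp only [this, Finset.mul_sum]
      rw [Finset.sum_comm]
      exact Finset.sum_congr rfl fun i _ => Finset.sum_comm
    rw [e1, pet_inner_eq]
    simp only [hfr0]
    simp [Fin.sum_univ_four]
    ring
  refine ⟨?_, ?_, ?_⟩
  · intro c hc
    have h := hdeg c hc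
    unfold pet_adj at h
    rw [Finset.sum_boole] at h
    have hset : {c' : E4 | c' ∈ C ∧ ⟪c, c'⟫ = (-2 / 3 : ℝ)} =
        ((C.filter fun x => ⟪c, x⟫ = (-2 / 3 : ℝ) : Finset E4) : Set E4) := by
      ext; simp
    rw [hset, Set.ncard_coe_finset]
    exact_mod_cast h
  · rintro c hc c' hc' h ⟨x, hx, h1, h2⟩
    have hn : (0 : ℝ) ≤ ⟪c + c' + x, c + c' + x⟫ := real_inner_self_nonneg
    simp only [inner_add_left, inner_add_right, hself c hc, hself c' hc', hself x hx, h, h1, h2,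
      real_inner_comm c c', real_inner_comm c x, real_inner_comm c' x] at hn
    norm_num at hn
  · intro c hc c' hc' hne h
    have hadj : pet_adj c c' = 0 := by unfold pet_adj; rw [h]; norm_num
    have hadj' : pet_adj c' c = 0 := by unfold pet_adj; rw [real_inner_comm, h]; norm_num
    have ht := htight c c'
    have hterm : ∀ x ∈ C, ⟪c, x⟫ * ⟪c', x⟫ =
        (1/36 - 5/36 * pet_adj c x - 5/36 * pet_adj c' x + 25/36 * (pet_adj c x * pet_adj c' x)
          + 5/36 * (if c = x then 1 else 0) + 5/36 * (if c' = x then 1 else 0) : ℝ) := by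
      intro x hx
      rw [hip c hc x hx, hip c' hc' x hx]
      by_cases h1 : c = x
      · subst h1
        rw [hadj_self c hc, hadj']
        simp [hne.symm]
        norm_num
      · by_cases h2 : c' = x
        · subst h2
          rw [hadj_self c' hc', hadj]
          simp [hne]
          norm_num
        · simp only [h1, h2, if_false]
          ring
    rw [Finset.sum_congr rfl hterm] at ht
    simp only [Finset.sum_add_distrib, Finset.sum_sub_distrib, ← Finset.mul_sum,
      Finset.sum_ite_eq, if_pos hc, if_pos hc', Finset.sum_const, hcard, hdeg c hc, hdeg c' hc',
      h] at ht
    have hone : ∑ x ∈ C, pet_adj c x * pet_adj c' x = 1 := by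
      norm_num at ht
      linarith
    have hprod : ∀ x, pet_adj c x * pet_adj c' x =
        if ⟪c, x⟫ = (-2/3 : ℝ) ∧ ⟪c', x⟫ = (-2/3 : ℝ) then 1 else 0 := by
      intro x
      unfold pet_adj
      by_cases h1 : ⟪c, x⟫ = (-2/3 : ℝ)
      · by_cases h2 : ⟪c', x⟫ = (-2/3 : ℝ)
        · rw [if_pos h1, if_pos h2, if_pos ⟨h1, h2⟩, mul_one]
        · rw [if_neg h2, mul_zero, if_neg (fun h => h2 h.2)]
      · rw [if_neg h1, zero_mul, if_neg (fun h => h1 h.1)]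
    simp only [hprod] at hone
    rw [Finset.sum_boole] at hone
    have hcard1 : (C.filter fun x => ⟪c, x⟫ = (-2/3 : ℝ) ∧ ⟪c', x⟫ = (-2/3 : ℝ)).card = 1 := by
      exact_mod_cast hone
    obtain ⟨z, hz⟩ := Finset.card_eq_one.1 hcard1
    refine ⟨z, ?_, ?_⟩
    · have : z ∈ C.filter fun x => ⟪c, x⟫ = (-2/3 : ℝ) ∧ ⟪c', x⟫ = (-2/3 : ℝ) := by
        rw [hz]; exact Finset.mem_singleton_self z
      simpa using this
    · intro y hy
      have : y ∈ C.filter fun x => ⟪c, x⟫ = (-2/3 : ℝ) ∧ ⟪c', x⟫ = (-2/3 : ℝ) := by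
        simpa using hy
      rw [hz] at this
      exact Finset.mem_singleton.1 this
end
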